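/- arXiv:2505.07221 — 2 statements merged into one kernel-verified Lean document; each statement's English description precedes it below -/
import Mathlib

section
/- Let k ≥ 2 be an integer. For every admissible index κ of weight k there exist integers c_{κ;l} (l ∈ I^{≥2}_k) such that ζ(κ) = Σ_{l∈I^{≥2}_k} c_{κ;l}·ζ(l). In particular, the ℤ-submodule of ℝ spanned by {ζ(κ) : κ ∈ I^adm_k} equals the ℤ-submodule spanned by {ζ(l) : l ∈ I^{≥2}_k}. -/
open scoped Classical

/-- Multiple zeta value of an index given as a list `(k₁, …, k_r)`:
`ζ(k) = ∑_{0 < n₁ < ⋯ < n_r} 1/(n₁^{k₁} ⋯ n_r^{k_r})`. -/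
noncomputable def mzvL (k : List ℕ) : ℝ :=
  ∑' n : {n : Fin k.length → ℕ // StrictMono n ∧ ∀ i, 0 < n i},
    ∏ i, (1 : ℝ) / ((n.1 i : ℝ) ^ k.get i)

namespace MzvAux
open Finset

/-- all words of length `n` -/
def words : ℕ → Finset (List Bool)
  | 0 => {[]}
  | n + 1 => ((univ : Finset Bool) ×ˢ words n).image (fun p => p.1 :: p.2)

theorem mem_words (n : ℕ) (u : List Bool) : u ∈ words n ↔ u.length = n := by
  induction n generalizing u with
  | zero => simp [words]
  | succ n ih =>
    cases u with
    | nil => simp [words]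
    | cons b u => simp [words, ih]

theorem sum_words_succ {M : Type*} [AddCommMonoid M] (n : ℕ) (F : List Bool → M) :
    ∑ u ∈ words (n + 1), F u
      = ∑ u ∈ words n, F (true :: u) + ∑ u ∈ words n, F (false :: u) := by
  rw [words, Finset.sum_image (by rintro ⟨a, b⟩ _ ⟨c, d⟩ _ h; simpa using h), Finset.sum_product]
  simp

/-- head of the (reversed) word is `y` -/
def sh (u : List Bool) : ℕ := if u.head? = some false then 1 else 0

/-- modified multiple harmonic sums; words are reversed, `true = x`, `false = y` -/
noncomputable def cc (N : ℕ) : List Bool → ℕ → ℝ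
  | [] => fun _ => 1
  | b :: u => fun m => ∑ i ∈ range m,
      (if b then cc N u (i + 1) / (i + 1) else cc N u (i + sh u) / ((N : ℝ) - (i + 1)))

def ev {R : Type*} [Ring R] (e : Bool → R) : List Bool → R
  | [] => 1
  | b :: u => ev e u * e b

theorem ev_append {R : Type*} [Ring R] (e : Bool → R) (u v : List Bool) :
    ev e (u ++ v) = ev e v * ev e u := by
  induction u with
  | nil => simp [ev]
  | cons b u ih => simp [ev, ih, mul_assoc]

section alg
variable {R : Type*} [Ring R] [Algebra ℝ R]

noncomputable def S (e : Bool → R) (k : ℕ) (c : List Bool → ℝ) : R :=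
  ∑ n ∈ range (k + 1), ∑ u ∈ words n, c u • ev e u

/-- half step -/
noncomputable def hf (N m : ℕ) (u : List Bool) : ℝ := cc N u (m + sh u)

theorem S_step (e : Bool → R) (k : ℕ) (b : Bool) (s : ℝ) (c d : List Bool → ℝ)
    (h0 : d [] = c []) (h1 : ∀ u, d (b :: u) = c (b :: u) + s * d u)
    (h2 : ∀ u, d ((!b) :: u) = c ((!b) :: u))
    (hk : ∀ u, u.length = k + 1 → ev e u = 0) :
    S e k d * (1 - s • e b) = S e k c := by
  have key : ∀ n, ∑ u ∈ words (n + 1), d u • ev e u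
      = ∑ u ∈ words (n + 1), c u • ev e u + (∑ u ∈ words n, d u • ev e u) * (s • e b) := by
    intro n
    rw [sum_words_succ, sum_words_succ, Finset.sum_mul]
    have hh : ∀ u, (s * d u) • ev e (b :: u) = d u • ev e u * s • e b := by
      intro u
      rw [smul_mul_smul_comm, mul_comm, ev]
    cases b
    · simp only [Bool.not_false] at h2
      simp only [h2, h1, add_smul, Finset.sum_add_distrib, hh]
      rw [add_assoc]
    · simp only [Bool.not_true] at h2
      simp only [h2, h1, add_smul, Finset.sum_add_distrib, hh]
      rw [add_right_comm]
  have hz : (∑ u ∈ words k, d u • ev e u) * (s • e b) = 0 := by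
    rw [Finset.sum_mul]
    refine Finset.sum_eq_zero fun u hu => ?_
    have := hk (b :: u) (by simp [(mem_words k u).1 hu])
    rw [ev] at this
    simp [this]
  have main : ∀ j, (∑ n ∈ range (j + 1), ∑ u ∈ words n, d u • ev e u)
      = (∑ n ∈ range (j + 1), ∑ u ∈ words n, c u • ev e u)
       + (∑ n ∈ range j, ∑ u ∈ words n, d u • ev e u) * (s • e b) := by
    intro j
    induction j with
    | zero => simp [words, h0]
    | succ j ih =>
      conv_lhs => rw [Finset.sum_range_succ, ih, key]
      conv_rhs => rw [Finset.sum_range_succ _ (j + 1),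
        Finset.sum_range_succ (fun n => ∑ u ∈ words n, d u • ev e u) j, add_mul]
      abel
  rw [mul_sub, mul_one, S, S]
  have h3 := main k
  rw [sub_eq_iff_eq_add, h3, ← h3, Finset.sum_range_succ (fun n => ∑ u ∈ words n, d u • ev e u) k,
    add_mul, hz, add_zero, ← h3, Finset.sum_range_succ]

theorem cc_zero (N : ℕ) (b : Bool) (u : List Bool) : cc N (b :: u) 0 = 0 := by simp [cc]

theorem S_cc_zero (e : Bool → R) (k N : ℕ) : S e k (fun u => cc N u 0) = 1 := by
  rw [S, Finset.sum_range_succ']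
  have h : ∀ n ∈ range k, ∑ u ∈ words (n + 1), cc N u 0 • ev e u = 0 := by
    intro n _
    rw [sum_words_succ]; simp [cc_zero]
  rw [Finset.sum_eq_zero h]
  simp [words, ev, cc]

theorem S_cc_succ (e : Bool → R) (k N m : ℕ) (hk : ∀ u, u.length = k + 1 → ev e u = 0) :
    S e k (fun u => cc N u (m + 1)) * (1 - ((1 : ℝ) / (m + 1)) • e true)
      * (1 - ((1 : ℝ) / ((N : ℝ) - (m + 1))) • e false) = S e k (fun u => cc N u m) := by
  rw [S_step e k true _ (hf N m) (fun u => cc N u (m + 1)), S_step e k false _ (fun u => cc N u m)]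
  · simp [hf, cc]
  · intro u
    simp [hf, cc, sh, Finset.sum_range_succ]; ring
  · intro u; simp [hf, sh]
  · exact hk
  · simp [hf, cc]
  · intro u
    simp [hf, cc, sh, Finset.sum_range_succ]; ring
  · intro u; simp [hf, sh]
  · exact hk

noncomputable def qq (e : Bool → R) (N : ℕ) : ℕ → R
  | 0 => 1
  | m + 1 => ((m + 1 : ℝ) • 1 - e true) * (((N : ℝ) - (m + 1)) • 1 - e false) * qq e N m

theorem S_qq (e : Bool → R) (k N : ℕ) (hk : ∀ u, u.length = k + 1 → ev e u = 0) :
    ∀ m, m + 1 ≤ N → S e k (fun u => cc N u m) * qq e N m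
      = (∏ i ∈ range m, ((i + 1 : ℝ) * ((N : ℝ) - (i + 1)))) • 1 := by
  intro m
  induction m with
  | zero => intro _; simp [S_cc_zero, qq]
  | succ m ih =>
    intro hm
    have hN : (N : ℝ) - (m + 1) ≠ 0 := by
      have : ((m + 1 + 1 : ℕ) : ℝ) ≤ N := by exact_mod_cast hm
      push_cast at this
      intro h; linarith
    have hm1 : (m + 1 : ℝ) ≠ 0 := by positivity
    rw [qq, Finset.prod_range_succ, mul_comm, ← smul_smul, ← smul_smul, ← ih (by omega),
      ← S_cc_succ e k N m hk]
    have h1 : ((m + 1 : ℝ) • (1 : R) - e true)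
        = (m + 1 : ℝ) • (1 - ((1 : ℝ) / (m + 1)) • e true) := by
      rw [smul_sub, smul_smul, mul_one_div_cancel hm1, one_smul]
    have h2 : (((N : ℝ) - (m + 1)) • (1 : R) - e false)
        = ((N : ℝ) - (m + 1)) • (1 - ((1 : ℝ) / ((N : ℝ) - (m + 1))) • e false) := by
      rw [smul_sub, smul_smul, mul_one_div_cancel hN, one_smul]
    rw [h1, h2]
    simp only [smul_mul_assoc, mul_smul_comm, mul_assoc]
    rw [smul_comm]

theorem qq_swap (e e' : Bool → R) (N : ℕ)
    (hs : ∀ m : ℝ, (((N : ℝ) - m) • 1 - e false) * (m • 1 - e true)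
      = (m • 1 - e' true) * (((N : ℝ) - m) • 1 - e' false)) (m : ℕ) :
    qq e (N + 1) (m + 1) = ((m + 1 : ℝ) • 1 - e true) * qq e' N m * ((N : ℝ) • 1 - e false) := by
  induction m with
  | zero => simp [qq]
  | succ m ih =>
    rw [qq, ih, qq]
    have := hs (m + 1)
    have e1 : (((N + 1 : ℕ) : ℝ) - ((m + 1 : ℕ) + 1)) = (N : ℝ) - (m + 1) := by push_cast; ring
    rw [e1]
    push_cast
    simp only [mul_assoc]
    congr 1
    simp only [← mul_assoc]
    rw [this]

end alg

section mat
variable {k : ℕ}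

def Up (d : ℕ) (M : Matrix (Fin (k + 1)) (Fin (k + 1)) ℤ) : Prop :=
  ∀ i j : Fin (k + 1), (j : ℕ) < i + d → M i j = 0

theorem Up.mul {a b : ℕ} {M M' : Matrix (Fin (k + 1)) (Fin (k + 1)) ℤ} (h : Up a M)
    (h' : Up b M') : Up (a + b) (M * M') := by
  intro i j hij
  rw [Matrix.mul_apply]
  refine Finset.sum_eq_zero fun l _ => ?_
  by_cases hl : (l : ℕ) < i + a
  · rw [h i l hl, zero_mul]
  · rw [h' l j (by omega), mul_zero]

theorem Up.add {a : ℕ} {M M' : Matrix (Fin (k + 1)) (Fin (k + 1)) ℤ} (h : Up a M)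
    (h' : Up a M') : Up a (M + M') := by
  intro i j hij
  rw [Matrix.add_apply, h i j hij, h' i j hij, add_zero]

theorem Up.sub {a : ℕ} {M M' : Matrix (Fin (k + 1)) (Fin (k + 1)) ℤ} (h : Up a M)
    (h' : Up a M') : Up a (M - M') := by
  intro i j hij
  rw [Matrix.sub_apply, h i j hij, h' i j hij, sub_zero]

theorem Up.mono {a b : ℕ} {M : Matrix (Fin (k + 1)) (Fin (k + 1)) ℤ} (h : Up a M)
    (hab : b ≤ a) : Up b M := fun i j hij => h i j (by omega)

theorem Up.eq_zero {a : ℕ} {M : Matrix (Fin (k + 1)) (Fin (k + 1)) ℤ} (h : Up a M)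
    (ha : k + 1 ≤ a) : M = 0 := by
  ext i j
  exact h i j (by omega)

theorem up_zero (a : ℕ) : Up a (0 : Matrix (Fin (k + 1)) (Fin (k + 1)) ℤ) := fun _ _ _ => rfl

theorem up_one : Up 0 (1 : Matrix (Fin (k + 1)) (Fin (k + 1)) ℤ) := by
  intro i j hij
  exact Matrix.one_apply_ne (by intro h; subst h; omega)

theorem Up.pow {M : Matrix (Fin (k + 1)) (Fin (k + 1)) ℤ} (h : Up 1 M) (n : ℕ) :
    Up n (M ^ n) := by
  induction n with
  | zero => simpa using up_one
  | succ n ih => rw [pow_succ]; exact ih.mul h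

theorem Up.ev {e : Bool → Matrix (Fin (k + 1)) (Fin (k + 1)) ℤ} (h : ∀ b, Up 1 (e b))
    (u : List Bool) : Up u.length (ev e u) := by
  induction u with
  | nil => simpa [MzvAux.ev] using up_one
  | cons b u ih => rw [MzvAux.ev]; exact ih.mul (h b)

theorem exists_inv {M : Matrix (Fin (k + 1)) (Fin (k + 1)) ℤ} (h : Up 1 M) :
    ∃ p, p * (1 - M) = 1 ∧ (1 - M) * p = 1 ∧ Up 2 (p - 1 - M) := by
  have hM : M ^ (k + 1) = 0 := (h.pow (k + 1)).eq_zero le_rfl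
  have h1 : (∑ i ∈ range (k + 1), M ^ i) * (1 - M) = 1 := by rw [geom_sum_mul_neg, hM, sub_zero]
  have h2 : (1 - M) * (∑ i ∈ range (k + 1), M ^ i) = 1 := by rw [mul_neg_geom_sum, hM, sub_zero]
  have h0 : ∀ n, Up 0 (∑ i ∈ range n, M ^ i) := by
    intro n
    induction n with
    | zero => simpa using up_zero 0
    | succ n ih => rw [Finset.sum_range_succ]; exact ih.add ((h.pow n).mono (by omega))
  have h3 := h0 (k + 1)
  generalize (∑ i ∈ range (k + 1), M ^ i) = q at h1 h2 h3
  refine ⟨q, h1, h2, ?_⟩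
  have e1 : q = 1 + M * q := by
    rw [sub_mul, one_mul, sub_eq_iff_eq_add] at h2; exact h2
  have e2 : q - 1 - M = M * M * q := by
    have : q = 1 + M * (1 + M * q) := by rw [← e1, ← e1]
    calc q - 1 - M = (1 + M * (1 + M * q)) - 1 - M := by rw [← this]
      _ = M * M * q := by noncomm_ring
  rw [e2]
  exact (h.mul h).mul h3

theorem exists_eps {X Y : Matrix (Fin (k + 1)) (Fin (k + 1)) ℤ} (hX : Up 1 X) (hY : Up 1 Y) :
    ∃ ε, Up 2 ε ∧ (X + ε) * (Y + ε) = ε + Y * X := by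
  let F : Matrix (Fin (k + 1)) (Fin (k + 1)) ℤ → Matrix (Fin (k + 1)) (Fin (k + 1)) ℤ :=
    fun a => (X + a) * (Y + a) - Y * X
  have hF : ∀ a, F a = (X + a) * (Y + a) - Y * X := fun _ => rfl
  have h2 : ∀ n, Up 2 (F^[n] 0) := by
    intro n
    induction n with
    | zero => exact up_zero 2
    | succ n ih =>
      rw [Function.iterate_succ_apply', hF]
      exact Up.sub (Up.mul (hX.add (ih.mono (by omega))) (hY.add (ih.mono (by omega)))) (hY.mul hX)
  have hd : ∀ n, Up (n + 2) (F^[n + 1] 0 - F^[n] 0) := by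
    intro n
    induction n with
    | zero =>
      have := h2 1
      simpa using this
    | succ n ih =>
      have e : F^[n + 1 + 1] 0 - F^[n + 1] 0 = (X + F^[n + 1] 0) * (F^[n + 1] 0 - F^[n] 0)
          + (F^[n + 1] 0 - F^[n] 0) * (Y + F^[n] 0) := by
        conv_lhs => rw [Function.iterate_succ_apply', hF]
        conv_lhs =>
          enter [2]
          rw [Function.iterate_succ_apply', hF]
        noncomm_ring
      rw [e]
      refine Up.add ?_ ?_
      · exact (Up.mul (hX.add ((h2 _).mono (by omega))) ih).mono (by omega)
      · exact (Up.mul ih (hY.add ((h2 _).mono (by omega)))).mono (by omega)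
  refine ⟨F^[k] 0, h2 k, ?_⟩
  have := (hd k).eq_zero (by omega)
  rw [Function.iterate_succ_apply', hF] at this
  have h3 := sub_eq_zero.1 this
  rw [← sub_eq_iff_eq_add]; exact h3

theorem ev_first {e : Bool → Matrix (Fin (k + 1)) (Fin (k + 1)) ℤ} (h : ∀ b, Up 1 (e b))
    {ε : Matrix (Fin (k + 1)) (Fin (k + 1)) ℤ} (hε : Up 2 ε)
    (he : (e true + ε) * (e false + ε) = ε + e false * e true) (u : List Bool) :
    Up (u.length + 2) (ev (fun b => e b + ε) u - ev e u -
      (ev e u * e false - e false * ev e u - ev e u * e true + e true * ev e u)) := by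
  have h3 : Up 3 (ε - (e true * e false - e false * e true)) := by
    have : ε - (e true * e false - e false * e true) = e true * ε + ε * e false + ε * ε := by
      have h4 : ε = (e true + ε) * (e false + ε) - e false * e true := by rw [he]; simp
      calc _ = ((e true + ε) * (e false + ε) - e false * e true)
            - (e true * e false - e false * e true) := by rw [← h4]
        _ = _ := by noncomm_ring
    rw [this]
    exact (((h true).mul hε).add (hε.mul (h false))).add ((hε.mul hε).mono (by omega))
  induction u with
  | nil => simpa [ev] using up_zero 2
  | cons b u ih =>
    have hU := Up.ev h u
    simp only [ev, List.length_cons]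
    set U := ev e u
    set V := ev (fun b => e b + ε) u
    have hI : Up (u.length + 1) (U * e false - e false * U - U * e true + e true * U) :=
      (((hU.mul (h false)).sub (((h false).mul hU).mono (by omega))).sub (hU.mul (h true))).add
        (((h true).mul hU).mono (by omega))
    have key : V * (e b + ε) - U * e b -
        (U * e b * e false - e false * (U * e b) - U * e b * e true + e true * (U * e b))
        = (V - U - (U * e false - e false * U - U * e true + e true * U)) * (e b + ε)
          + (U * e false - e false * U - U * e true + e true * U) * ε
          + U * (ε - (e true * e false - e false * e true)) := by
      cases b <;> noncomm_ring
    rw [key]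
    refine Up.add (Up.add ?_ ?_) ?_
    · exact (ih.mul ((h b).add (hε.mono (by omega)))).mono (by omega)
    · exact (hI.mul hε).mono (by omega)
    · exact (hU.mul h3).mono (by omega)

/-- the reversed prefix of length `j` of the infinite word `l` -/
def pre (l : ℕ → Bool) : ℕ → List Bool
  | 0 => []
  | j + 1 => l j :: pre l j

theorem pre_length (l : ℕ → Bool) (j : ℕ) : (pre l j).length = j := by
  induction j with
  | zero => rfl
  | succ j ih => simp [pre, ih]

def Lt (k : ℕ) (l : ℕ → Bool) (b : Bool) : Matrix (Fin (k + 1)) (Fin (k + 1)) ℤ :=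
  fun i j => if (j : ℕ) = i + 1 ∧ l i = b then 1 else 0

theorem up_Lt (l : ℕ → Bool) (b : Bool) : Up 1 (Lt k l b) := by
  intro i j hij
  rw [Lt, if_neg]; omega

theorem ev_Lt (l : ℕ → Bool) (u : List Bool) (j : Fin (k + 1)) :
    ev (Lt k l) u 0 j = if u = pre l j then 1 else 0 := by
  induction u generalizing j with
  | nil =>
    obtain ⟨j, hj⟩ := j
    cases j with
    | zero => simp only [ev, pre, if_true]; exact Matrix.one_apply_eq 0
    | succ j => simp [ev, pre, Fin.ext_iff]
  | cons b u ih =>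
    rw [ev, Matrix.mul_apply]
    obtain ⟨j, hj⟩ := j
    cases j with
    | zero => simp [Lt, pre]
    | succ j =>
      rw [Finset.sum_eq_single ⟨j, by omega⟩]
      · rw [ih]
        simp only [Lt, pre, List.cons.injEq]
        by_cases h1 : u = pre l j <;> by_cases h2 : l j = b <;> simp [h1, h2]
        intro h; exact h2 h.symm
      · intro i _ hi
        rw [Lt, if_neg, mul_zero]
        rintro ⟨h, _⟩
        apply hi
        ext; simp at h ⊢; omega
      · simp

/-- reversed words which start (chronologically) with `y` and end with `x`. -/
def Adm (u : List Bool) : Prop := ∃ v, u = true :: (v ++ [false])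

theorem adm_or (u : List Bool) :
    u = [] ∨ Adm u ∨ (∃ v, u = false :: v) ∨ (∃ v, u = v ++ [true]) := by
  rcases List.eq_nil_or_concat u with h | ⟨v, b, h⟩
  · exact Or.inl h
  · right
    rw [List.concat_eq_append] at h
    subst h
    cases b
    · cases v with
      | nil => right; left; exact ⟨[], rfl⟩
      | cons c v =>
        cases c
        · right; left; exact ⟨_, rfl⟩
        · left; exact ⟨v, rfl⟩
    · right; right; exact ⟨_, rfl⟩

theorem exists_coeff (k : ℕ) (hk : 2 ≤ k) (l : ℕ → Bool) (h0 : l 0 = false)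
    (h1 : l (k - 1) = true) :
    ∃ ε p r : Matrix (Fin (k + 1)) (Fin (k + 1)) ℤ,
      (∀ b, Up 1 (Lt k l b + ε)) ∧
      (Lt k l true + ε) * (Lt k l false + ε) = ε + Lt k l false * Lt k l true ∧
      (1 - Lt k l false) * p = 1 ∧ (1 - Lt k l true) * r = 1 ∧
      (∀ v, (p * ev (fun b => Lt k l b + ε) (v ++ [true]) * r) 0 (Fin.last k) = 0) ∧
      (∀ v, (p * ev (fun b => Lt k l b + ε) (false :: v) * r) 0 (Fin.last k) = 0) ∧
      (∀ u, u.length + 1 = k → (p * ev (fun b => Lt k l b + ε) u * r) 0 (Fin.last k) = 0) ∧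
      (∀ u, u.length = k → (p * ev (fun b => Lt k l b + ε) u * r) 0 (Fin.last k)
        = if u = pre l k then 1 else 0) := by
  obtain ⟨ε, hε, he⟩ := exists_eps (up_Lt (k := k) l true) (up_Lt l false)
  obtain ⟨p, hp1, hp2, hp3⟩ := exists_inv (up_Lt (k := k) l false)
  obtain ⟨r, hr1, hr2, hr3⟩ := exists_inv (up_Lt (k := k) l true)
  have hL := fun b => up_Lt (k := k) l b
  have hU : ∀ b, Up 1 (Lt k l b + ε) := fun b => (up_Lt l b).add (hε.mono (by omega))
  obtain ⟨q, hq1, hq2, -⟩ := exists_inv (hU false)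
  obtain ⟨s, hs1, hs2, -⟩ := exists_inv (hU true)
  have rowX : ∀ M : Matrix (Fin (k + 1)) (Fin (k + 1)) ℤ, ∀ j, (Lt k l true * M) 0 j = 0 := by
    intro M j
    rw [Matrix.mul_apply]
    refine Finset.sum_eq_zero fun i _ => ?_
    rw [Lt, if_neg, zero_mul]
    simp [h0]
  have colY : ∀ M : Matrix (Fin (k + 1)) (Fin (k + 1)) ℤ, ∀ j,
      (M * Lt k l false) j (Fin.last k) = 0 := by
    intro M j
    rw [Matrix.mul_apply]
    refine Finset.sum_eq_zero fun i _ => ?_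
    rw [Lt, if_neg, mul_zero]
    rintro ⟨h2, h3⟩
    have : (i : ℕ) = k - 1 := by simp at h2; omega
    rw [this, h1] at h3
    exact absurd h3 (by simp)
  refine ⟨ε, p, r, hU, he, hp2, hr2, ?_, ?_, ?_, ?_⟩
  · intro v
    have e1 : p * (Lt k l true + ε) = Lt k l true * q := by
      have e2 : (Lt k l true + ε) * (1 - (Lt k l false + ε)) = (1 - Lt k l false) * Lt k l true := by
        rw [mul_sub, he]; noncomm_ring
      calc p * (Lt k l true + ε) = p * ((Lt k l true + ε) * (1 - (Lt k l false + ε))) * q := by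
            rw [mul_assoc, mul_assoc, hq2, mul_one]
        _ = (p * (1 - Lt k l false)) * Lt k l true * q := by rw [e2]; noncomm_ring
        _ = _ := by rw [hp1, one_mul]
    rw [ev_append]
    simp only [ev, one_mul]
    rw [← mul_assoc, e1, mul_assoc, mul_assoc]
    exact rowX _ _
  · intro v
    have e1 : (Lt k l false + ε) * r = s * Lt k l false := by
      have e2 : (1 - (Lt k l true + ε)) * (Lt k l false + ε) = Lt k l false * (1 - Lt k l true) := by
        rw [sub_mul, he]; noncomm_ring
      calc (Lt k l false + ε) * r
            = s * ((1 - (Lt k l true + ε)) * (Lt k l false + ε)) * r := by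
            rw [← mul_assoc, hs1, one_mul]
        _ = s * Lt k l false * ((1 - Lt k l true) * r) := by rw [e2]; noncomm_ring
        _ = _ := by rw [hr2, mul_one]
    rw [ev, mul_assoc, mul_assoc, e1, ← mul_assoc, ← mul_assoc]
    exact colY _ _
  · intro u hu
    have h2 := ev_first hL hε he u
    have h3 := Up.ev hL u
    have h4 := Up.ev hU u
    have z0 : (ev (Lt k l) u) 0 (Fin.last k) = 0 := by
      rw [ev_Lt, if_neg]
      intro h
      have := congrArg List.length h
      rw [pre_length] at this
      simp at this; omega
    set U := ev (Lt k l) u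
    set V := ev (fun b => Lt k l b + ε) u
    set X := Lt k l true
    set Y := Lt k l false
    -- expand
    have key : p * V * r = (V - U - (U * Y - Y * U - U * X + X * U)) + U + (U * Y + X * U)
        + (Y * (V - U) + (p - 1 - Y) * V) + ((V - U) * X + (p - 1) * V * X + p * V * (r - 1 - X)) := by
      noncomm_ring
    have hX : Up 1 X := hL true
    have hY : Up 1 Y := hL false
    have hI : Up (u.length + 1) (U * Y - Y * U - U * X + X * U) :=
      (((h3.mul hY).sub ((hY.mul h3).mono (by omega))).sub (h3.mul hX)).add
        ((hX.mul h3).mono (by omega))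
    have hVU : Up (u.length + 1) (V - U) := by
      have := (h2.mono (b := u.length + 1) (by omega)).add hI
      simpa using this
    have hp1' : Up 1 (p - 1) := by
      have := (hp3.mono (b := 1) (by omega)).add hY
      simpa using this
    have hp0 : Up 0 p := by
      have := (hp1'.mono (b := 0) (by omega)).add up_one
      simpa using this
    have b1 := h2 0 (Fin.last k) (by simp; omega)
    have b2 : (Y * (V - U) + (p - 1 - Y) * V) 0 (Fin.last k) = 0 :=
      (((hY.mul hVU).mono (b := k + 1) (by omega)).add ((hp3.mul h4).mono (by omega))) _ _
        (by simp)
    have b3 : ((V - U) * X + (p - 1) * V * X + p * V * (r - 1 - X)) 0 (Fin.last k) = 0 :=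
      ((((hVU.mul hX).mono (b := k + 1) (by omega)).add
        (((hp1'.mul h4).mul hX).mono (by omega))).add
        (((hp0.mul h4).mul hr3).mono (by omega))) _ _ (by simp)
    rw [key]
    simp only [Matrix.add_apply (U * Y), Matrix.add_apply (_ + _ + (U * Y + X * U)),
      Matrix.add_apply (_ + _ + (U * Y + X * U) + _), Matrix.add_apply (_ + U), Matrix.add_apply _ U,
      rowX, colY, z0, b1, b2, b3]
    simp
  · intro u hu
    have h2 := ev_first hL hε he u
    have h3 := Up.ev hL u
    have h4 := Up.ev hU u
    rw [show (if u = pre l k then (1 : ℤ) else 0) = ev (Lt k l) u 0 (Fin.last k) by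
      rw [ev_Lt]; simp]
    set U := ev (Lt k l) u
    set V := ev (fun b => Lt k l b + ε) u
    set X := Lt k l true
    set Y := Lt k l false
    have hX : Up 1 X := hL true
    have hY : Up 1 Y := hL false
    have hI : Up (u.length + 1) (U * Y - Y * U - U * X + X * U) :=
      (((h3.mul hY).sub ((hY.mul h3).mono (by omega))).sub (h3.mul hX)).add
        ((hX.mul h3).mono (by omega))
    have hVU : Up (u.length + 1) (V - U) := by
      have := (h2.mono (b := u.length + 1) (by omega)).add hI
      simpa using this
    have hp1' : Up 1 (p - 1) := by
      have := (hp3.mono (b := 1) (by omega)).add hY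
      simpa using this
    have hr1' : Up 1 (r - 1) := by
      have := (hr3.mono (b := 1) (by omega)).add hX
      simpa using this
    have hp0 : Up 0 p := by
      have := (hp1'.mono (b := 0) (by omega)).add up_one
      simpa using this
    have hall : Up (k + 1) (p * V * r - U) := by
      have : p * V * r - U = (V - U) + (p - 1) * V + p * V * (r - 1) := by noncomm_ring
      rw [this]
      exact ((hVU.mono (by omega)).add ((hp1'.mul h4).mono (by omega))).add
        (((hp0.mul h4).mul hr1').mono (by omega))
    exact sub_eq_zero.1 (by simpa using hall 0 (Fin.last k) (by simp))

theorem ev_smul_map (N : ℝ) (e : Bool → Matrix (Fin (k + 1)) (Fin (k + 1)) ℤ) (u : List Bool) :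
    ev (fun b => N • (Int.castRingHom ℝ).mapMatrix (e b)) u
      = N ^ u.length • (Int.castRingHom ℝ).mapMatrix (ev e u) := by
  induction u with
  | nil => simp [ev]
  | cons b u ih =>
    rw [ev, ih, ev, map_mul, smul_mul_smul_comm, List.length_cons, pow_succ]

theorem cc_rec (k : ℕ) (l : ℕ → Bool)
    (ε p r : Matrix (Fin (k + 1)) (Fin (k + 1)) ℤ)
    (hU : ∀ b, Up 1 (Lt k l b + ε))
    (he : (Lt k l true + ε) * (Lt k l false + ε) = ε + Lt k l false * Lt k l true)
    (hp : (1 - Lt k l false) * p = 1) (hr : (1 - Lt k l true) * r = 1) (M : ℕ) :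
    cc (M + 2) (pre l k) (M + 1) * ((M : ℝ) + 1) ^ k
      = ∑ n ∈ range (k + 1), ∑ u ∈ words n, cc (M + 1) u M * ((M : ℝ) + 1) ^ n
        * ((p * ev (fun b => Lt k l b + ε) u * r) 0 (Fin.last k) : ℤ) := by
  set φ := (Int.castRingHom ℝ).mapMatrix (m := Fin (k + 1)) with hφ
  set N : ℝ := (M : ℝ) + 1 with hN
  have hN0 : N ≠ 0 := by positivity
  set e : Bool → Matrix (Fin (k + 1)) (Fin (k + 1)) ℝ := fun b => N • φ (Lt k l b) with he0
  set e' : Bool → Matrix (Fin (k + 1)) (Fin (k + 1)) ℝ := fun b => N • φ (Lt k l b + ε) with he1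
  have hev : ∀ u, ev e u = N ^ u.length • φ (ev (Lt k l) u) := fun u => ev_smul_map N _ u
  have hev' : ∀ u, ev e' u = N ^ u.length • φ (ev (fun b => Lt k l b + ε) u) :=
    fun u => ev_smul_map N _ u
  have hz : ∀ u, u.length = k + 1 → ev e u = 0 := by
    intro u hu
    rw [hev, (Up.ev (fun b => up_Lt (k := k) l b) u).eq_zero (by omega)]; simp
  have hz' : ∀ u, u.length = k + 1 → ev e' u = 0 := by
    intro u hu
    rw [hev', (Up.ev hU u).eq_zero (by omega)]; simp
  have hs : ∀ m : ℝ, ((((M + 1 : ℕ) : ℝ) - m) • 1 - e false) * (m • 1 - e true)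
      = (m • 1 - e' true) * ((((M + 1 : ℕ) : ℝ) - m) • 1 - e' false) := by
    intro m
    have hh := congrArg φ he
    rw [map_mul, map_add φ ε, map_mul] at hh
    simp only [he0, he1]
    push_cast
    rw [← hN]
    simp only [sub_mul, mul_sub, hh, one_mul, mul_one, smul_mul_assoc,
      mul_smul_comm]
    rw [map_add, map_add]
    module
  set E := S e k (fun u => cc (M + 2) u (M + 1)) with hE
  set E' := S e' k (fun u => cc (M + 1) u M) with hE'
  have q1 := S_qq e k (M + 2) hz (M + 1) (by omega)
  have q2 := S_qq e' k (M + 1) hz' M (by omega)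
  rw [show M + 2 = (M + 1) + 1 from rfl, qq_swap e e' (M + 1) hs M] at q1
  set s0 := ∏ i ∈ range M, ((i + 1 : ℝ) * (((M + 1 : ℕ) : ℝ) - (i + 1))) with hs0
  have hs0' : s0 ≠ 0 := by
    rw [hs0]
    refine Finset.prod_ne_zero_iff.2 fun i hi => ?_
    have : ((i : ℝ)) < M := by exact_mod_cast Finset.mem_range.1 hi
    push_cast
    have h2 : (M : ℝ) + 1 - (i + 1) ≠ 0 := by intro h; linarith
    exact mul_ne_zero (by positivity) h2
  have hs1 : ∏ i ∈ range (M + 1), ((i + 1 : ℝ) * (((M + 1 + 1 : ℕ) : ℝ) - (i + 1)))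
      = N * N * s0 := by
    rw [Finset.prod_mul_distrib, Finset.prod_range_succ, Finset.prod_range_succ', hs0,
      Finset.prod_mul_distrib]
    have : ∀ i : ℕ, (((M + 1 + 1 : ℕ) : ℝ) - (((i + 1 : ℕ) : ℝ) + 1))
        = ((M + 1 : ℕ) : ℝ) - (i + 1) := by intro i; push_cast; ring
    simp only [this]
    rw [hN]; push_cast; ring
  rw [hs1] at q1
  set q := qq e' (M + 1) M
  have hp' := congrArg φ hp
  have hr' := congrArg φ hr
  rw [map_mul, map_sub, map_one] at hp' hr'
  have x1 : ((M + 1 : ℝ) • (1 : Matrix (Fin (k + 1)) (Fin (k + 1)) ℝ) - e true)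
      = N • (1 - φ (Lt k l true)) := by rw [smul_sub]
  have x2 : (((M + 1 : ℕ) : ℝ) • (1 : Matrix (Fin (k + 1)) (Fin (k + 1)) ℝ) - e false)
      = N • (1 - φ (Lt k l false)) := by rw [smul_sub, hN]; push_cast; rfl
  rw [x1, x2] at q1
  have q3 : E * (1 - φ (Lt k l true)) * q * (1 - φ (Lt k l false)) = s0 • 1 := by
    have : (N * N) • (E * (1 - φ (Lt k l true)) * q * (1 - φ (Lt k l false)))
        = (N * N) • (s0 • 1) := by
      rw [smul_smul, ← q1]
      simp only [smul_mul_assoc, mul_smul_comm, mul_assoc, mul_smul]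
      rfl
    exact smul_right_injective _ (mul_ne_zero hN0 hN0) this
  have q4 : q * E' = s0 • 1 := by
    have : (s0⁻¹ • E') * q = 1 := by
      rw [smul_mul_assoc, q2, smul_smul, inv_mul_cancel₀ hs0', one_smul]
    have h2 := mul_eq_one_comm.1 this
    rw [mul_smul_comm] at h2
    rw [← h2, smul_smul, mul_inv_cancel₀ hs0', one_smul]
  have q5 : E = φ p * E' * φ r := by
    have a1 : E * (1 - φ (Lt k l true)) * q = s0 • φ p := by
      calc _ = E * (1 - φ (Lt k l true)) * q * ((1 - φ (Lt k l false)) * φ p) := by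
            rw [hp', mul_one]
        _ = _ := by rw [← mul_assoc, q3, smul_mul_assoc, one_mul]
    have a2 : s0 • (E * (1 - φ (Lt k l true))) = s0 • (φ p * E') := by
      calc _ = E * (1 - φ (Lt k l true)) * (q * E') := by
            rw [q4, mul_smul_comm, mul_one]
        _ = _ := by rw [← mul_assoc, a1, smul_mul_assoc]
    have a3 := smul_right_injective _ hs0' a2
    rw [← a3, mul_assoc, hr', mul_one]
  have hent := congrFun (congrFun q5 0) (Fin.last k)
  have lhs : E 0 (Fin.last k) = cc (M + 2) (pre l k) (M + 1) * N ^ k := by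
    rw [hE, S]
    simp only [Matrix.sum_apply]
    rw [Finset.sum_eq_single k, Finset.sum_eq_single (pre l k)]
    · rw [hev, pre_length]
      have := ev_Lt (k := k) l (pre l k) (Fin.last k)
      simp [hφ, this]
    · intro u hu hne
      rw [hev]
      have := ev_Lt (k := k) l u (Fin.last k)
      simp [hφ, this, hne]
    · intro h; exact absurd ((mem_words _ _).2 (pre_length l k)) h
    · intro n hn hne
      refine Finset.sum_eq_zero fun u hu => ?_
      rw [hev]
      have := ev_Lt (k := k) l u (Fin.last k)
      have h2 : u ≠ pre l k := by
        intro h; apply hne; rw [← (mem_words _ _).1 hu, h, pre_length]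
      simp [hφ, this, h2]
    · intro h; simp at h
  rw [← lhs, hent, hE', S, Finset.mul_sum, Finset.sum_mul, Matrix.sum_apply]
  refine Finset.sum_congr rfl fun n _ => ?_
  rw [Finset.mul_sum, Finset.sum_mul, Matrix.sum_apply]
  refine Finset.sum_congr rfl fun u hu => ?_
  rw [hev', (mem_words _ _).1 hu, smul_smul, mul_smul_comm, smul_mul_assoc, ← map_mul, ← map_mul]
  simp [hφ]

theorem exists_pre (w : List Bool) : ∃ l, pre l w.length = w := by
  have hc : ∀ (l l' : ℕ → Bool) n, (∀ i < n, l i = l' i) → pre l n = pre l' n := by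
    intro l l' n
    induction n with
    | zero => intro _; rfl
    | succ n ih =>
      intro h
      rw [pre, pre, h n (by omega), ih (fun i hi => h i (by omega))]
  induction w with
  | nil => exact ⟨fun _ => true, rfl⟩
  | cons b w ih =>
    obtain ⟨l, hl⟩ := ih
    refine ⟨Function.update l w.length b, ?_⟩
    rw [List.length_cons, pre, Function.update_self]
    congr 1
    rw [← hl, pre_length]
    apply hc
    intro i hi
    rw [Function.update_of_ne (by omega)]

theorem main_rec (w : List Bool) (hw : Adm w) :
    ∃ C : List Bool → ℤ, (∀ u, u ≠ [] → ¬ Adm u → C u = 0) ∧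
      ∀ M : ℕ, cc (M + 2) w (M + 1) = cc (M + 1) w M
        + ∑ n ∈ range (w.length - 1), ∑ u ∈ words n,
            C u * (cc (M + 1) u M * (1 / ((M : ℝ) + 1) ^ (w.length - n))) := by
  obtain ⟨l, hl⟩ := exists_pre w
  obtain ⟨v, hv⟩ := hw
  set k := w.length with hk
  have hk2 : k = v.length + 2 := by rw [hk, hv]; simp
  have h1 : l (k - 1) = true := by
    rw [hk2, pre, hv] at hl
    rw [hk2]
    exact (List.cons.inj hl).1
  have h0 : l 0 = false := by
    have hpl : ∀ n, ∃ v, pre l (n + 1) = v ++ [l 0] := by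
      intro n
      induction n with
      | zero => exact ⟨[], rfl⟩
      | succ n ih =>
        obtain ⟨v, hv⟩ := ih
        exact ⟨l (n + 1) :: v, by rw [pre, hv]; rfl⟩
    obtain ⟨v', hv'⟩ := hpl (v.length + 1)
    rw [← hk2, hl, hv, ← List.cons_append] at hv'
    have := List.append_inj' hv' rfl
    simpa using this.2.symm
  obtain ⟨ε, p, r, hU, he, hp, hr, c1, c2, c3, c4⟩ := exists_coeff k (by omega) l h0 h1
  refine ⟨fun u => (p * ev (fun b => Lt k l b + ε) u * r) 0 (Fin.last k), ?_, ?_⟩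
  · intro u hu hna
    rcases adm_or u with h | h | ⟨v, h⟩ | ⟨v, h⟩
    · exact absurd h hu
    · exact absurd h hna
    · rw [h]; exact c2 v
    · rw [h]; exact c1 v
  · intro M
    have hN : ((M : ℝ) + 1) ≠ 0 := by positivity
    have := cc_rec k l ε p r hU he hp hr M
    have hsplit : ∀ G : ℕ → ℝ, ∑ n ∈ range k, G n = ∑ n ∈ range (k - 1), G n + G (k - 1) := by
      intro G
      rw [← Finset.sum_range_succ, show k - 1 + 1 = k by omega]
    rw [hl, Finset.sum_range_succ, hsplit] at this
    have s1 : ∑ u ∈ words (k - 1), cc (M + 1) u M * ((M : ℝ) + 1) ^ (k - 1)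
        * ((p * ev (fun b => Lt k l b + ε) u * r) 0 (Fin.last k) : ℤ) = 0 := by
      refine Finset.sum_eq_zero fun u hu => ?_
      have := (mem_words _ _).1 hu
      rw [c3 u (by omega)]; simp
    have s2 : ∑ u ∈ words k, cc (M + 1) u M * ((M : ℝ) + 1) ^ k
        * ((p * ev (fun b => Lt k l b + ε) u * r) 0 (Fin.last k) : ℤ)
        = cc (M + 1) w M * ((M : ℝ) + 1) ^ k := by
      rw [Finset.sum_eq_single w]
      · rw [c4 w rfl, hl]; simp
      · intro u hu hne
        rw [c4 u ((mem_words _ _).1 hu), hl, if_neg hne]; simp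
      · intro h; exact absurd ((mem_words _ _).2 rfl) h
    rw [s1, s2, add_zero] at this
    apply mul_right_cancel₀ (pow_ne_zero k hN)
    rw [this, add_mul, add_comm, Finset.sum_mul]
    congr 1
    refine Finset.sum_congr rfl fun n hn => ?_
    rw [Finset.sum_mul]
    refine Finset.sum_congr rfl fun u hu => ?_
    have hn' : n < k - 1 := Finset.mem_range.1 hn
    have : ((M : ℝ) + 1) ^ k = ((M : ℝ) + 1) ^ n * ((M : ℝ) + 1) ^ (k - n) := by
      rw [← pow_add]; congr 1; omega
    rw [this]
    have h3 : ((M : ℝ) + 1) ^ (k - n) ≠ 0 := pow_ne_zero _ hN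
    field_simp

end mat
open Filter Topology

/-- the transported summand -/
noncomputable def ff (N : ℕ) : List Bool → ℕ → ℝ
  | [] => fun n => if n = 0 then 1 else 0
  | b :: u => fun n => if b then ff N u n / n else
      if u.head? = some false then
        (∑ i ∈ range n, (N : ℝ) / ((N : ℝ) - i) * ff N u i) / n + ff N u n / ((N : ℝ) - n)
      else (∑ i ∈ range n, ff N u i) / n

noncomputable def gg : List Bool → ℕ → ℝ
  | [] => fun n => if n = 0 then 1 else 0
  | b :: u => fun n => if b then gg u n / n else (∑ i ∈ range n, gg u i) / n

theorem ff_zero (N : ℕ) (u : List Bool) (hu : u ≠ []) : ff N u 0 = 0 := by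
  induction u with
  | nil => exact absurd rfl hu
  | cons b u ih =>
    rw [ff]
    cases b
    · by_cases h : u.head? = some false
      · have : u ≠ [] := by rintro rfl; simp at h
        simp [h, ih this]
      · simp [h]
    · simp

noncomputable def Cn (K n m : ℕ) : ℝ := (m.choose n : ℝ) / (K.choose n : ℝ)

theorem choose_real (m j : ℕ) :
    ((m.choose (j + 1) : ℕ) : ℝ) * (j + 1) = (m.choose j : ℝ) * ((m : ℝ) - j) := by
  by_cases h : j ≤ m
  · have := Nat.choose_succ_right_eq m j
    have h2 : ((m.choose (j + 1) * (j + 1) : ℕ) : ℝ) = ((m.choose j * (m - j) : ℕ) : ℝ) := by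
      rw [this]
    push_cast [Nat.cast_sub h] at h2
    exact h2
  · rw [Nat.choose_eq_zero_of_lt (by omega), Nat.choose_eq_zero_of_lt (by omega)]; simp

theorem choose_real' (m j : ℕ) :
    (((m + 1).choose (j + 1) : ℕ) : ℝ) * (j + 1) = ((m : ℝ) + 1) * (m.choose j : ℝ) := by
  have := Nat.add_one_mul_choose_eq m j
  have h2 : (((m + 1) * m.choose j : ℕ) : ℝ) = (((m + 1).choose (j + 1) * (j + 1) : ℕ) : ℝ) := by
    rw [this]
  push_cast at h2
  exact h2.symm

theorem Cn_diff (K n m : ℕ) : Cn K n (m + 1) - Cn K n m = n / ((m : ℝ) + 1) * Cn K n (m + 1) := by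
  cases n with
  | zero => simp [Cn]
  | succ j =>
    have h1 := choose_real' m j
    have h2 : (((m + 1).choose (j + 1) : ℕ) : ℝ) = m.choose j + m.choose (j + 1) := by
      rw [Nat.choose_succ_succ]; push_cast; rfl
    have hm : (m : ℝ) + 1 ≠ 0 := by positivity
    have h3 : (((m + 1).choose (j + 1) : ℕ) : ℝ) - m.choose (j + 1)
        = ((j : ℝ) + 1) / ((m : ℝ) + 1) * ((m + 1).choose (j + 1) : ℕ) := by
      field_simp
      linear_combination ((m : ℝ) + 1) * h2 - h1
    rw [Cn, Cn, ← sub_div, h3]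
    push_cast
    ring

theorem Cn_tele (K j m : ℕ) (hj : j < K) (hm : m < K) :
    Cn K (j + 1) (m + 1) = ((m : ℝ) + 1) / ((K : ℝ) - m) * (Cn K j m - Cn K (j + 1) m) := by
  have h1 := choose_real' m j
  have h2 := choose_real m j
  have h3 := choose_real K j
  have hd : (K.choose j : ℝ) ≠ 0 := by
    exact_mod_cast (Nat.choose_pos hj.le).ne'
  have hd' : (K.choose (j + 1) : ℝ) ≠ 0 := by
    exact_mod_cast (Nat.choose_pos hj).ne'
  have hj1 : (j : ℝ) + 1 ≠ 0 := by positivity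
  have hm' : (m : ℝ) < K := by exact_mod_cast hm
  have hj' : (j : ℝ) < K := by exact_mod_cast hj
  have hKm : (K : ℝ) - m ≠ 0 := by intro h; linarith
  have hKj : (K : ℝ) - j ≠ 0 := by intro h; linarith
  have e1 : Cn K (j + 1) (m + 1) = ((m : ℝ) + 1) * m.choose j / (K.choose j * ((K : ℝ) - j)) := by
    rw [Cn, ← h1, ← h3]; field_simp
  have e2 : Cn K (j + 1) m = (m.choose j : ℝ) * ((m : ℝ) - j) / (K.choose j * ((K : ℝ) - j)) := by
    rw [Cn, ← h2, ← h3]; field_simp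
  rw [e1, e2, Cn]
  field_simp
  ring

theorem Cn_sum (K n m : ℕ) (hn : n ≤ K) (hm : m < K) :
    ∑ i ∈ Ioo n (K + 1), Cn K i (m + 1) = ((m : ℝ) + 1) / ((K : ℝ) - m) * Cn K n m := by
  have h0 : Cn K K m = 0 := by rw [Cn, Nat.choose_eq_zero_of_lt hm]; simp
  have h1 : ∀ d, d ≤ K → ∑ i ∈ Ioo (K - d) (K + 1), Cn K i (m + 1)
      = ((m : ℝ) + 1) / ((K : ℝ) - m) * Cn K (K - d) m := by
    intro d
    induction d with
    | zero =>
      intro _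
      have hI : Ioo K (K + 1) = ∅ := by ext x; simp
      simp [h0, hI]
    | succ d ih =>
      intro hd
      have e : Ioo (K - (d + 1)) (K + 1) = insert (K - d) (Ioo (K - d) (K + 1)) := by
        ext x; simp; omega
      rw [e, Finset.sum_insert (by simp), ih (by omega)]
      have := Cn_tele K (K - (d + 1)) m (by omega) hm
      rw [show K - (d + 1) + 1 = K - d by omega] at this
      rw [this]; ring
  have := h1 (K - n) (by omega)
  rwa [show K - (K - n) = n by omega] at this

theorem cc_rep (K : ℕ) (u : List Bool) (hu : u = [] ∨ ∃ v, u = v ++ [false]) :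
    ∀ m, m ≤ K → cc (K + 1) u m = ∑ n ∈ range (K + 1), ff (K + 1) u n * Cn K n m := by
  induction u with
  | nil =>
    intro m _
    rw [Finset.sum_eq_single 0]
    · simp [cc, ff, Cn]
    · intro b _ hb; simp [ff, hb]
    · simp
  | cons b u ih =>
    have hu' : u = [] ∨ ∃ v, u = v ++ [false] := by
      rcases hu with h | ⟨v, h⟩
      · simp at h
      · cases v with
        | nil => left; simp at h; exact h.2
        | cons c v => right; exact ⟨v, (List.cons.inj h).2⟩
    have ih := ih hu'
    intro m
    induction m with
    | zero =>
      intro _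
      rw [Finset.sum_eq_zero]
      · simp [cc]
      · intro n _
        cases n with
        | zero => rw [ff_zero _ _ (by simp), zero_mul]
        | succ n => simp [Cn]
    | succ m ihm =>
      intro hm
      have hmK : (m : ℝ) < K := by exact_mod_cast hm
      have hKm : (K : ℝ) - m ≠ 0 := by intro h; linarith
      have hm1 : (m : ℝ) + 1 ≠ 0 := by positivity
      have hcc : cc (K + 1) (b :: u) (m + 1) = cc (K + 1) (b :: u) m +
        (if b then cc (K + 1) u (m + 1) / (m + 1)
          else cc (K + 1) u (m + sh u) / (((K + 1 : ℕ) : ℝ) - (m + 1))) := by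
        simp only [cc]; rw [Finset.sum_range_succ]
      rw [hcc, ihm (by omega)]
      symm
      rw [← sub_eq_iff_eq_add', ← Finset.sum_sub_distrib]
      have e1 : ∀ n, ff (K + 1) (b :: u) n * Cn K n (m + 1) - ff (K + 1) (b :: u) n * Cn K n m
          = (ff (K + 1) (b :: u) n * n) * (Cn K n (m + 1) / (m + 1)) := by
        intro n
        rw [← mul_sub, Cn_diff]; ring
      simp only [e1]
      have hK1 : (((K + 1 : ℕ) : ℝ) - (m + 1)) = (K : ℝ) - m := by push_cast; ring
      rw [hK1]
      have hswap : ∀ F : ℕ → ℝ, ∑ n ∈ range (K + 1), (∑ i ∈ range n, F i) * (Cn K n (m + 1) / (m + 1))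
          = ∑ i ∈ range (K + 1), F i * (Cn K i m / ((K : ℝ) - m)) := by
        intro F
        simp only [Finset.sum_mul]
        rw [Finset.sum_comm' (t' := range (K + 1)) (s' := fun i => Ioo i (K + 1))]
        · refine Finset.sum_congr rfl fun i hi => ?_
          rw [← Finset.mul_sum, ← Finset.sum_div, Cn_sum K i m (by simp at hi; omega) (by omega)]
          field_simp
        · intro x y; simp; omega
      cases b
      · by_cases h : u.head? = some false
        · have hne : u ≠ [] := by rintro rfl; simp at h
          have hg : ∀ n ∈ range (K + 1), (ff (K + 1) (false :: u) n * n) * (Cn K n (m + 1) / (m + 1))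
              = (∑ i ∈ range n, ((K + 1 : ℕ) : ℝ) / (((K + 1 : ℕ) : ℝ) - i) * ff (K + 1) u i)
                * (Cn K n (m + 1) / (m + 1))
              + ff (K + 1) u n / (((K + 1 : ℕ) : ℝ) - n) * n * (Cn K n (m + 1) / (m + 1)) := by
            intro n _
            rw [ff]
            simp only [h, Bool.false_eq_true, if_false, if_true]
            cases n with
            | zero => simp
            | succ n =>
              have : ((n + 1 : ℕ) : ℝ) ≠ 0 := by positivity
              rw [← add_mul, add_mul, div_mul_cancel₀ _ this]
          rw [Finset.sum_congr rfl hg, Finset.sum_add_distrib, hswap, ← Finset.sum_add_distrib]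
          simp only [sh, h, Bool.false_eq_true, if_false, if_true]
          rw [ih (m + 1) hm, Finset.sum_div]
          refine Finset.sum_congr rfl fun i hi => ?_
          have hi' : (i : ℝ) < ((K + 1 : ℕ) : ℝ) := by exact_mod_cast Finset.mem_range.1 hi
          push_cast at hi' ⊢
          have hKi : (K : ℝ) + 1 - i ≠ 0 := by intro h; linarith
          have hd := Cn_diff K i m
          have hd' : Cn K i m = Cn K i (m + 1) - i / ((m : ℝ) + 1) * Cn K i (m + 1) := by linarith
          rw [hd']
          field_simp
          ring
        · have hg : ∀ n ∈ range (K + 1), (ff (K + 1) (false :: u) n * n) * (Cn K n (m + 1) / (m + 1))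
              = (∑ i ∈ range n, ff (K + 1) u i) * (Cn K n (m + 1) / (m + 1)) := by
            intro n _
            rw [ff]
            simp only [h, Bool.false_eq_true, if_false]
            cases n with
            | zero => simp
            | succ n =>
              have : ((n + 1 : ℕ) : ℝ) ≠ 0 := by positivity
              rw [div_mul_cancel₀ _ this]
          rw [Finset.sum_congr rfl hg, hswap]
          simp only [sh, h, Bool.false_eq_true, if_false, add_zero]
          rw [ih m (by omega), Finset.sum_div]
          refine Finset.sum_congr rfl fun i hi => ?_
          ring
      · have hne : u ≠ [] := by
          rintro rfl
          rcases hu with h | ⟨v, h⟩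
          · simp at h
          · cases v <;> simp at h
        simp only [if_true]
        rw [ih (m + 1) hm, Finset.sum_div]
        refine Finset.sum_congr rfl fun n _ => ?_
        rw [ff]
        simp only [if_true]
        cases n with
        | zero => simp [ff_zero _ _ hne]
        | succ n =>
          have : ((n + 1 : ℕ) : ℝ) ≠ 0 := by positivity
          rw [div_mul_cancel₀ _ this]; ring

theorem cc_eq_sum (K : ℕ) (u : List Bool) (hu : u = [] ∨ ∃ v, u = v ++ [false]) :
    cc (K + 1) u K = ∑ n ∈ range (K + 1), ff (K + 1) u n := by
  rw [cc_rep K u hu K le_rfl]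
  refine Finset.sum_congr rfl fun n hn => ?_
  have : (K.choose n : ℝ) ≠ 0 := by
    exact_mod_cast (Nat.choose_pos (by simp at hn; omega)).ne'
  rw [Cn, div_self this, mul_one]

theorem ff_tendsto (u : List Bool) (n : ℕ) :
    Tendsto (fun N => ff N u n) atTop (𝓝 (gg u n)) := by
  induction u generalizing n with
  | nil => exact tendsto_const_nhds
  | cons b u ih =>
    cases b
    · by_cases h : u.head? = some false
      · simp only [ff, gg, h, Bool.false_eq_true, if_false, if_true]
        have hT : ∀ i : ℕ, Tendsto (fun N : ℕ => (N : ℝ) - i) atTop atTop := fun i =>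
          tendsto_atTop_add_const_right _ _ tendsto_natCast_atTop_atTop
        have h1 : ∀ i : ℕ, Tendsto (fun N : ℕ => (N : ℝ) / ((N : ℝ) - i)) atTop (𝓝 1) := by
          intro i
          have h2 : Tendsto (fun N : ℕ => 1 + (i : ℝ) / ((N : ℝ) - i)) atTop (𝓝 (1 + 0)) :=
            tendsto_const_nhds.add ((hT i).const_div_atTop _)
          rw [add_zero] at h2
          refine h2.congr' ?_
          filter_upwards [eventually_gt_atTop i] with N hN
          have : (i : ℝ) < N := by exact_mod_cast hN
          have : (N : ℝ) - i ≠ 0 := by intro h; linarith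
          field_simp; ring
        have h3 : Tendsto (fun N : ℕ => (∑ i ∈ range n, (N : ℝ) / ((N : ℝ) - i) * ff N u i) / n
            + ff N u n / ((N : ℝ) - n)) atTop (𝓝 ((∑ i ∈ range n, 1 * gg u i) / n + 0)) := by
          refine Tendsto.add (Tendsto.div_const (tendsto_finsetSum _ fun i _ => (h1 i).mul (ih i)) _) ?_
          exact (ih n).div_atTop (hT n)
        simpa using h3
      · simp only [ff, gg, h, Bool.false_eq_true, if_false]
        exact Tendsto.div_const (tendsto_finsetSum _ fun i _ => ih i) _
    · simp only [ff, gg, if_true]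
      exact (ih n).div_const _


theorem ff_nonneg (N : ℕ) (u : List Bool) (n : ℕ) (hn : n < N) : 0 ≤ ff N u n := by
  induction u generalizing n with
  | nil => simp only [ff]; split_ifs <;> norm_num
  | cons b u ih =>
    have hN : ∀ i : ℕ, i < N → (0 : ℝ) < (N : ℝ) - i := fun i hi => by
      have : (i : ℝ) < N := by exact_mod_cast hi
      linarith
    have h1 : 0 ≤ ∑ i ∈ range n, (N : ℝ) / ((N : ℝ) - i) * ff N u i :=
      Finset.sum_nonneg fun i hi => by
        have hi' : i < N := by have := Finset.mem_range.1 hi; omega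
        exact mul_nonneg (div_nonneg (Nat.cast_nonneg _) (hN i hi').le) (ih i hi')
    have h2 : 0 ≤ ∑ i ∈ range n, ff N u i :=
      Finset.sum_nonneg fun i hi => by
        have hi' : i < N := by have := Finset.mem_range.1 hi; omega
        exact ih i hi'
    have h3 := hN n hn
    have h4 := ih n hn
    rw [ff]
    dsimp only
    split_ifs <;> positivity

noncomputable def hh (n : ℕ) : ℝ := 1 + ∑ i ∈ range n, 1 / ((i : ℝ) + 1)

theorem hh_mono {m n : ℕ} (h : m ≤ n) : hh m ≤ hh n := by
  unfold hh
  have : ∑ i ∈ range m, 1 / ((i : ℝ) + 1) ≤ ∑ i ∈ range n, 1 / ((i : ℝ) + 1) :=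
    Finset.sum_le_sum_of_subset_of_nonneg (by simpa using h) fun i _ _ => by positivity
  linarith

theorem one_le_hh (n : ℕ) : 1 ≤ hh n := by
  unfold hh
  have : 0 ≤ ∑ i ∈ range n, 1 / ((i : ℝ) + 1) := Finset.sum_nonneg fun i _ => by positivity
  linarith

theorem sum_inv_le_hh (n : ℕ) : ∑ i ∈ range n, 1 / (i : ℝ) ≤ hh n := by
  cases n with
  | zero => simp [hh]
  | succ n =>
    rw [Finset.sum_range_succ']
    have := hh_mono (Nat.le_succ n)
    unfold hh at this ⊢
    push_cast
    simp at this ⊢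
    linarith

theorem sum_inv_le_hh' (N n : ℕ) (h : n ≤ N) : ∑ i ∈ range n, 1 / ((N : ℝ) - i) ≤ hh n := by
  have h1 : ∑ i ∈ range n, 1 / ((N : ℝ) - i) ≤ ∑ i ∈ range n, 1 / ((n : ℝ) - i) := by
    refine Finset.sum_le_sum fun i hi => ?_
    have hi' : (i : ℝ) < n := by exact_mod_cast Finset.mem_range.1 hi
    have hn : (n : ℝ) ≤ N := by exact_mod_cast h
    exact one_div_le_one_div_of_le (by linarith) (by linarith)
  have h2 : ∑ i ∈ range n, 1 / ((n : ℝ) - i) = ∑ i ∈ range n, 1 / ((i : ℝ) + 1) := by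
    rw [← Finset.sum_range_reflect]
    refine Finset.sum_congr rfl fun i hi => ?_
    have hi' : i < n := Finset.mem_range.1 hi
    rw [show n - 1 - i = n - (i + 1) by omega, Nat.cast_sub (by omega)]
    congr 1
    push_cast; ring
  rw [h2] at h1
  unfold hh
  linarith

theorem ff_bound (N : ℕ) (u : List Bool) (hu : ∃ v, u = v ++ [false]) (n : ℕ) (hn : n < N) :
    ff N u n ≤ (3 * hh n) ^ u.length / n := by
  induction u generalizing n with
  | nil => obtain ⟨v, h⟩ := hu; simp at h
  | cons b u ih =>
    rcases Nat.eq_zero_or_pos n with rfl | hn0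
    · rw [ff_zero _ _ (by simp)]; simp
    have hn1 : (1 : ℝ) ≤ n := by exact_mod_cast hn0
    have h1 := one_le_hh n
    obtain ⟨v, hv⟩ := hu
    cases v with
    | nil =>
      simp at hv
      obtain ⟨rfl, rfl⟩ := hv
      have : ff N [false] n = 1 / n := by
        simp [ff, hn0]
      rw [this]
      simp only [List.length_singleton, pow_one]
      gcongr
      linarith
    | cons c v =>
      have hu' : ∃ v, u = v ++ [false] := ⟨v, (List.cons.inj hv).2⟩
      have ih := ih hu'
      set A : ℝ := (3 * hh n) ^ u.length with hA
      have hA1 : 1 ≤ A := one_le_pow₀ (by linarith)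
      have hAi : ∀ i, i ≤ n → ff N u i ≤ A * (1 / i) := by
        intro i hi
        refine (ih i (by omega)).trans ?_
        rw [mul_one_div]
        have := hh_mono hi
        have := one_le_hh i
        rw [hA]
        gcongr
      have hS : ∑ i ∈ range n, ff N u i ≤ A * hh n := by
        refine (Finset.sum_le_sum fun i hi => hAi i (Finset.mem_range.1 hi).le).trans ?_
        rw [← Finset.mul_sum]
        have := sum_inv_le_hh n
        gcongr
      have hl : (3 * hh n) ^ (b :: u).length = 3 * (A * hh n) := by
        rw [List.length_cons, pow_succ]; ring
      rw [hl]
      have hAh : A ≤ A * hh n := le_mul_of_one_le_right (by linarith) h1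
      rw [ff]
      dsimp only
      split_ifs with hb hw
      · gcongr
        refine (hAi n le_rfl).trans ?_
        have : 1 / (n : ℝ) ≤ 1 := by rw [div_le_one (by linarith)]; exact hn1
        nlinarith
      · have hW : ∑ i ∈ range n, (N : ℝ) / ((N : ℝ) - i) * ff N u i ≤ A * (hh n + hh n) := by
          have : ∀ i ∈ range n, (N : ℝ) / ((N : ℝ) - i) * ff N u i
              ≤ A * (1 / i + 1 / ((N : ℝ) - i)) := by
            intro i hi
            have hi' := Finset.mem_range.1 hi
            have hiN : (i : ℝ) < N := by exact_mod_cast (by omega : i < N)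
            have hNi : 0 < (N : ℝ) - i := by linarith
            refine (mul_le_mul_of_nonneg_left (hAi i hi'.le) (by positivity)).trans ?_
            rcases Nat.eq_zero_or_pos i with rfl | hi0
            · simp; positivity
            · have : (0 : ℝ) < i := by exact_mod_cast hi0
              apply le_of_eq
              field_simp
              ring
          refine (Finset.sum_le_sum this).trans ?_
          rw [← Finset.mul_sum, Finset.sum_add_distrib]
          have := sum_inv_le_hh n
          have := sum_inv_le_hh' N n hn.le
          gcongr
        have hZ : ff N u n / ((N : ℝ) - n) ≤ A / n := by
          have hnN : (n : ℝ) + 1 ≤ N := by exact_mod_cast hn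
          refine (div_le_self (ff_nonneg _ _ _ hn) (by linarith)).trans ?_
          have := hAi n le_rfl
          rwa [mul_one_div] at this
        calc _ ≤ A * (hh n + hh n) / n + A / n := by gcongr
          _ = (A * (hh n + hh n) + A) / n := by ring
          _ ≤ _ := by gcongr; linarith
      · gcongr
        linarith

theorem hh_le_log (n : ℕ) (ε : ℝ) (hε : 0 < ε) (hn : 1 ≤ n) :
    hh n ≤ (2 + 1 / ε) * (n : ℝ) ^ ε := by
  have h1 := harmonic_le_one_add_log n
  have h2 := Real.log_le_rpow_div (Nat.cast_nonneg n) hε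
  have h3 : (1 : ℝ) ≤ (n : ℝ) ^ ε := Real.one_le_rpow (by exact_mod_cast hn) hε.le
  have h4 : hh n = 1 + (harmonic n : ℝ) := by
    unfold hh harmonic; push_cast; simp
  rw [h4]
  have : (2 + 1 / ε) * (n : ℝ) ^ ε = 2 * (n : ℝ) ^ ε + (n : ℝ) ^ ε / ε := by ring
  linarith

theorem summable_bound (a : ℕ) : Summable fun n : ℕ => (3 * hh n) ^ (a + 1) / n / n := by
  set ε : ℝ := 1 / (2 * ((a : ℝ) + 1)) with he
  have hε : 0 < ε := by positivity
  have hs : Summable fun n : ℕ => (3 * (2 + 1 / ε)) ^ (a + 1) * (1 / (n : ℝ) ^ (3 / 2 : ℝ)) :=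
    (Real.summable_one_div_nat_rpow.2 (by norm_num)).mul_left _
  refine Summable.of_nonneg_of_le (fun n => ?_) (fun n => ?_) hs
  · have := one_le_hh n
    positivity
  · rcases Nat.eq_zero_or_pos n with rfl | hn
    · simp
    · have hn' : (0 : ℝ) < n := by exact_mod_cast hn
      have h1 := hh_le_log n ε hε hn
      have h2 := one_le_hh n
      have h3 : ((n : ℝ) ^ ε) ^ (a + 1) = (n : ℝ) ^ (1 / 2 : ℝ) := by
        rw [← Real.rpow_natCast, ← Real.rpow_mul hn'.le]
        congr 1
        rw [he]; push_cast; field_simp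
      calc (3 * hh n) ^ (a + 1) / n / n ≤ (3 * ((2 + 1 / ε) * (n : ℝ) ^ ε)) ^ (a + 1) / n / n := by
            gcongr
        _ = (3 * (2 + 1 / ε)) ^ (a + 1) * ((n : ℝ) ^ (1 / 2 : ℝ) / n / n) := by
            rw [← mul_assoc, mul_pow _ ((n : ℝ) ^ ε), h3]; ring
        _ = _ := by
            congr 1
            rw [div_div, div_eq_div_iff (by positivity) (by positivity), ← Real.rpow_add hn']
            norm_num
            ring

theorem tannery (u : List Bool) (hu : Adm u) :
    ∃ L, Tendsto (fun M => cc (M + 1) u M) atTop (𝓝 L) ∧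
      Tendsto (fun N => ∑ n ∈ range N, gg u n) atTop (𝓝 L) := by
  obtain ⟨v, rfl⟩ := hu
  set u := true :: (v ++ [false]) with hu
  set bd : ℕ → ℝ := fun n => (3 * hh n) ^ (v.length + 1) / n / n with hbd
  have hb : ∀ N n, n < N → ff N u n ≤ bd n := by
    intro N n hn
    have := ff_bound N (v ++ [false]) ⟨v, rfl⟩ n hn
    rw [hu, ff]
    simp only [if_true, hbd]
    simp only [List.length_append, List.length_singleton] at this
    gcongr
  have hbd0 : ∀ n, 0 ≤ bd n := fun n => by
    have := one_le_hh n
    simp only [hbd]; positivity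
  have hsb : Summable bd := summable_bound _
  have hg0 : ∀ n, 0 ≤ gg u n := fun n =>
    ge_of_tendsto (ff_tendsto u n) (by
      filter_upwards [eventually_gt_atTop n] with N hN using ff_nonneg N u n hN)
  have hgb : ∀ n, gg u n ≤ bd n := fun n =>
    le_of_tendsto (ff_tendsto u n) (by
      filter_upwards [eventually_gt_atTop n] with N hN using hb N n hN)
  have hgs : Summable (gg u) := Summable.of_nonneg_of_le hg0 hgb hsb
  refine ⟨∑' n, gg u n, ?_, hgs.hasSum.tendsto_sum_nat⟩
  have hT : Tendsto (fun N => ∑' n, if n < N then ff N u n else 0) atTop (𝓝 (∑' n, gg u n)) := by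
    refine tendsto_tsum_of_dominated_convergence hsb (fun n => ?_) (Eventually.of_forall fun N n => ?_)
    · refine (ff_tendsto u n).congr' ?_
      filter_upwards [eventually_gt_atTop n] with N hN
      rw [if_pos hN]
    · split_ifs with h
      · rw [Real.norm_of_nonneg (ff_nonneg N u n h)]; exact hb N n h
      · simpa using hbd0 n
  have := hT.comp (tendsto_add_atTop_nat 1)
  refine this.congr fun M => ?_
  rw [cc_eq_sum M u (Or.inr ⟨true :: v, rfl⟩)]
  simp only [Function.comp]
  rw [tsum_eq_sum (s := range (M + 1))]
  · exact Finset.sum_congr rfl fun n hn => if_pos (Finset.mem_range.1 hn)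
  · intro n hn
    exact if_neg (by simpa using hn)

/-- word of a reversed index -/
def wr : List ℕ → List Bool
  | [] => []
  | j :: ρ => List.replicate (j - 1) true ++ false :: wr ρ

/-- truncated sums of a reversed index -/
noncomputable def HH : List ℕ → ℕ → ℝ
  | [] => fun _ => 1
  | j :: ρ => fun N => ∑ x ∈ range N, 1 / (x : ℝ) ^ j * HH ρ x

theorem gg_replicate (a : ℕ) (u : List Bool) (n : ℕ) :
    gg (List.replicate a true ++ u) n = gg u n / (n : ℝ) ^ a := by
  induction a with
  | zero => simp
  | succ a ih =>
    rw [List.replicate_succ, List.cons_append, gg]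
    simp only [if_true, ih]
    rw [pow_succ, div_div]

theorem gg_wr (ρ : List ℕ) (h : ∀ y ∈ ρ, 1 ≤ y) (n : ℕ) (hn : 1 ≤ n) :
    ∑ i ∈ range n, gg (wr ρ) i = HH ρ n := by
  induction ρ generalizing n with
  | nil =>
    simp only [wr, gg, HH, Finset.sum_ite_eq', Finset.mem_range]
    rw [if_pos (by omega)]
  | cons j ρ ih =>
    have hj := h j (by simp)
    rw [HH]
    refine Finset.sum_congr rfl fun i _ => ?_
    rw [wr, gg_replicate]
    rcases Nat.eq_zero_or_pos i with rfl | hi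
    · have : j ≠ 0 := by omega
      simp [gg, this]
    · rw [gg]
      simp only [Bool.false_eq_true, if_false]
      rw [ih (fun y hy => h y (by simp [hy])) i hi]
      obtain ⟨a, rfl⟩ : ∃ a, j = a + 1 := ⟨j - 1, by omega⟩
      rw [Nat.add_sub_cancel, pow_succ', div_div, one_div, div_eq_inv_mul]

theorem wr_length (ρ : List ℕ) (h : ∀ y ∈ ρ, 1 ≤ y) : (wr ρ).length = ρ.sum := by
  induction ρ with
  | nil => simp [wr]
  | cons j ρ ih =>
    have hj := h j (by simp)
    simp only [wr, List.length_append, List.length_replicate, List.length_cons, List.sum_cons,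
      ih (fun y hy => h y (by simp [hy]))]
    omega

theorem wr_last (j : ℕ) (ρ : List ℕ) : ∃ v, wr (j :: ρ) = v ++ [false] := by
  induction ρ generalizing j with
  | nil => exact ⟨List.replicate (j - 1) true, by simp [wr]⟩
  | cons i ρ ih =>
    obtain ⟨v, hv⟩ := ih i
    refine ⟨List.replicate (j - 1) true ++ false :: v, ?_⟩
    rw [wr, hv]; simp

theorem wr_adm (j : ℕ) (ρ : List ℕ) (hj : 2 ≤ j) : Adm (wr (j :: ρ)) := by
  obtain ⟨v, hv⟩ := wr_last (j - 1) ρ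
  refine ⟨v, ?_⟩
  rw [← hv, wr, wr]
  obtain ⟨a, rfl⟩ : ∃ a, j = a + 2 := ⟨j - 2, by omega⟩
  simp [List.replicate_succ]

theorem lim_exists (j : ℕ) (ρ : List ℕ) (hj : 2 ≤ j) (h : ∀ y ∈ ρ, 1 ≤ y) :
    ∃ L, Tendsto (fun M => cc (M + 1) (wr (j :: ρ)) M) atTop (𝓝 L) ∧
      Tendsto (fun N => HH (j :: ρ) N) atTop (𝓝 L) := by
  obtain ⟨L, h1, h2⟩ := tannery _ (wr_adm j ρ hj)
  refine ⟨L, h1, h2.congr' ?_⟩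
  filter_upwards [eventually_ge_atTop 1] with N hN
  refine gg_wr _ (fun y hy => ?_) N hN
  rcases List.mem_cons.1 hy with rfl | hy
  · omega
  · exact h y hy

/-- span of the truncated sums with all entries at least two -/
def Pk (k : ℕ) : Submodule ℤ (ℕ → ℝ) :=
  Submodule.span ℤ {F | ∃ ρ : List ℕ, (∀ y ∈ ρ, 2 ≤ y) ∧ ρ.sum = k ∧ F = fun M => HH ρ (M + 1)}

theorem Pk_step (n j : ℕ) (hj : 2 ≤ j) (F : ℕ → ℝ) (hF : F ∈ Pk n) :
    (fun M => ∑ m ∈ range M, F m * (1 / ((m : ℝ) + 1) ^ j)) ∈ Pk (n + j) := by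
  induction hF using Submodule.span_induction with
  | mem F hF =>
    obtain ⟨ρ, h1, h2, rfl⟩ := hF
    refine Submodule.subset_span ⟨j :: ρ, ?_, ?_, ?_⟩
    · intro y hy
      rcases List.mem_cons.1 hy with rfl | hy
      · exact hj
      · exact h1 y hy
    · simp [h2, add_comm]
    · funext M
      simp only [HH]
      rw [Finset.sum_range_succ']
      have : j ≠ 0 := by omega
      simp only [Nat.cast_zero, zero_pow this, div_zero, zero_mul, add_zero]
      refine Finset.sum_congr rfl fun m _ => ?_
      push_cast; ring
  | zero => 
    convert (Pk (n + j)).zero_mem using 1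
    funext M; simp
  | add F G _ _ hF hG =>
    convert (Pk (n + j)).add_mem hF hG using 1
    funext M
    simp [add_mul, Finset.sum_add_distrib]
  | smul a F _ hF =>
    convert (Pk (n + j)).smul_mem a hF using 1
    funext M
    simp [Finset.mul_sum, mul_assoc]

theorem cc_mem_Pk (n : ℕ) : ∀ w : List Bool, w.length = n → (w = [] ∨ Adm w) →
    (fun M => cc (M + 1) w M) ∈ Pk n := by
  induction n using Nat.strong_induction_on with
  | _ n ih =>
    intro w hn hw
    rcases hw with rfl | hw
    · simp at hn
      subst hn
      refine Submodule.subset_span ⟨[], by simp, by simp, ?_⟩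
      funext M; simp [cc, HH]
    · obtain ⟨C, hC, hrec⟩ := main_rec w hw
      have hne : w ≠ [] := by obtain ⟨v, rfl⟩ := hw; simp
      have e : (fun M => cc (M + 1) w M) = ∑ i ∈ range (n - 1), ∑ u ∈ words i,
          C u • (fun M => ∑ m ∈ range M, cc (m + 1) u m * (1 / ((m : ℝ) + 1) ^ (n - i))) := by
        funext M
        simp only [Finset.sum_apply, Pi.smul_apply]
        simp only [zsmul_eq_mul]
        induction M with
        | zero =>
          cases w with
          | nil => exact absurd rfl hne
          | cons b w => simp [cc]
        | succ M ihM =>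
          rw [hrec M, ihM, hn, ← Finset.sum_add_distrib]
          refine Finset.sum_congr rfl fun i _ => ?_
          rw [← Finset.sum_add_distrib]
          refine Finset.sum_congr rfl fun u _ => ?_
          rw [Finset.sum_range_succ, mul_add]
      rw [e]
      refine Submodule.sum_mem _ fun i hi => Submodule.sum_mem _ fun u hu => ?_
      have hi' := Finset.mem_range.1 hi
      rw [mem_words] at hu
      by_cases hu2 : u = [] ∨ Adm u
      · refine Submodule.smul_mem _ _ ?_
        have := Pk_step i (n - i) (by omega) _ (ih i (by omega) u hu hu2)
        rwa [show i + (n - i) = n by omega] at this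
      · rw [not_or] at hu2
        rw [hC u hu2.1 hu2.2, zero_smul]
        exact Submodule.zero_mem _

/-- truncated sums, outermost variable smallest -/
noncomputable def GG : List ℕ → ℕ → ℕ → ℝ
  | [] => fun _ _ => 1
  | j :: l => fun a N => ∑ x ∈ Ioo a N, 1 / (x : ℝ) ^ j * GG l x N

theorem GG_snoc (l : List ℕ) (j a N : ℕ) :
    GG (l ++ [j]) a N = ∑ x ∈ Ioo a N, 1 / (x : ℝ) ^ j * GG l a x := by
  induction l generalizing a with
  | nil => simp [GG]
  | cons i l ih =>
    rw [List.cons_append, GG]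
    simp only [ih, GG, Finset.mul_sum]
    rw [Finset.sum_comm' (t' := Ioo a N) (s' := fun y => Ioo a y)]
    · refine Finset.sum_congr rfl fun y _ => Finset.sum_congr rfl fun x _ => ?_
      ring
    · intro x y; simp; omega

theorem HH_eq_GG (ρ : List ℕ) (h : ∀ y ∈ ρ, 1 ≤ y) (N : ℕ) : HH ρ N = GG ρ.reverse 0 N := by
  induction ρ generalizing N with
  | nil => simp [HH, GG]
  | cons j ρ ih =>
    have hj := h j (by simp)
    rw [List.reverse_cons, GG_snoc, HH]
    symm
    have hs : Ioo 0 N ⊆ range N := fun x hx => by simp at hx ⊢; omega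
    rw [Finset.sum_subset hs]
    · refine Finset.sum_congr rfl fun x _ => ?_
      rw [ih (fun y hy => h y (by simp [hy]))]
    · intro x h1 h2
      have : x = 0 := by simp at h1 h2; omega
      subst this
      have : j ≠ 0 := by omega
      simp [this]

/-- strictly increasing tuples in an interval -/
noncomputable def TT (r a N : ℕ) : Finset (Fin r → ℕ) :=
  (Fintype.piFinset fun _ : Fin r => range N).filter fun n => StrictMono n ∧ ∀ i, a < n i

theorem mem_TT (r a N : ℕ) (n : Fin r → ℕ) :
    n ∈ TT r a N ↔ (∀ i, n i < N) ∧ StrictMono n ∧ ∀ i, a < n i := by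
  simp [TT, Fintype.mem_piFinset]

theorem sum_TT (l : List ℕ) (a N : ℕ) :
    ∑ n ∈ TT l.length a N, ∏ i, (1 : ℝ) / ((n i : ℝ) ^ l.get i) = GG l a N := by
  induction l generalizing a with
  | nil =>
    have : TT ([] : List ℕ).length a N = {fun i => i.elim0} := by
      ext n
      rw [mem_TT, Finset.mem_singleton]
      constructor
      · intro _; funext i; exact i.elim0
      · rintro rfl
        exact ⟨fun i => i.elim0, fun i => i.elim0, fun i => i.elim0⟩
    rw [this]
    simp [GG]
  | cons j l ih =>
    rw [GG]
    simp only [← ih, Finset.mul_sum]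
    rw [Finset.sum_sigma']
    refine Finset.sum_bij' (i := fun n _ => (⟨n 0, fun i => n i.succ⟩ : (_ : ℕ) × (Fin l.length → ℕ)))
      (j := fun p _ => (Fin.cons p.1 p.2 : Fin (l.length + 1) → ℕ)) ?_ ?_ ?_ ?_ ?_
    · intro n hn
      obtain ⟨h1, h2, h3⟩ := (mem_TT _ _ _ _).1 hn
      rw [Finset.mem_sigma, mem_TT, Finset.mem_Ioo]
      exact ⟨⟨h3 _, h1 _⟩, fun i => h1 _, fun i i' hi => h2 (Fin.succ_lt_succ_iff.2 hi),
        fun i => h2 (Fin.succ_pos i)⟩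
    · rintro ⟨x, n⟩ hn
      rw [Finset.mem_sigma, mem_TT, Finset.mem_Ioo] at hn
      obtain ⟨⟨h1, h2⟩, h3, h4, h5⟩ := hn
      refine (mem_TT _ _ _ _).2 ⟨fun i => ?_, fun i i' hi => ?_, fun i => ?_⟩
      · refine Fin.cases ?_ (fun i => ?_) i
        · exact h2
        · exact h3 i
      · revert hi
        refine Fin.cases ?_ (fun i => ?_) i
        · refine Fin.cases ?_ (fun i' => ?_) i'
          · intro hi; exact absurd hi (lt_irrefl _)
          · intro _; exact h5 i'
        · refine Fin.cases ?_ (fun i' => ?_) i'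
          · intro hi; exact absurd hi (Fin.not_lt_zero _)
          · intro hi; exact h4 (Fin.succ_lt_succ_iff.1 hi)
      · refine Fin.cases ?_ (fun i => ?_) i
        · exact h1
        · exact lt_trans h1 (h5 i)
    · intro n hn
      funext i
      refine Fin.cases ?_ (fun i => ?_) i <;> rfl
    · rintro ⟨x, n⟩ hn
      rfl
    · intro n hn
      exact Fin.prod_univ_succ (n := l.length) (fun i => (1 : ℝ) / ((n i : ℝ) ^ (j :: l).get i))

theorem mzvL_eq (l : List ℕ) (L : ℝ) (h : Tendsto (fun N => GG l 0 N) atTop (𝓝 L)) :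
    mzvL l = L := by
  set f : (Fin l.length → ℕ) → ℝ := fun n => ∏ i, (1 : ℝ) / ((n i : ℝ) ^ l.get i) with hf
  set s : Set (Fin l.length → ℕ) := {n | StrictMono n ∧ ∀ i, 0 < n i} with hs
  have hf0 : ∀ n, 0 ≤ f n := fun n => Finset.prod_nonneg fun i _ => by positivity
  have hg0 : ∀ n, 0 ≤ s.indicator f n := fun n => Set.indicator_nonneg (fun n _ => hf0 n) n
  have hbox : ∀ N, ∑ n ∈ Fintype.piFinset (fun _ : Fin l.length => range N), s.indicator f n
      = GG l 0 N := by
    intro N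
    rw [← sum_TT, TT, Finset.sum_filter]
    refine Finset.sum_congr rfl fun n _ => ?_
    rw [Set.indicator_apply]
    rfl
  have hmono : Monotone fun N => GG l 0 N := by
    intro M N hMN
    simp only [← hbox]
    refine Finset.sum_le_sum_of_subset_of_nonneg ?_ fun n _ _ => hg0 n
    intro n hn
    rw [Fintype.mem_piFinset] at hn ⊢
    intro i
    have := Finset.mem_range.1 (hn i)
    exact Finset.mem_range.2 (by omega)
  have hsum : HasSum (s.indicator f) L := by
    refine hasSum_of_isLUB_of_nonneg _ hg0 ⟨?_, ?_⟩
    · rintro _ ⟨t, rfl⟩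
      obtain ⟨N, hN⟩ : ∃ N, t ⊆ Fintype.piFinset (fun _ : Fin l.length => range N) := by
        refine ⟨(t.sup fun n => univ.sup n) + 1, fun n hn => ?_⟩
        rw [Fintype.mem_piFinset]
        intro i
        rw [Finset.mem_range]
        have h1 : n i ≤ univ.sup n := Finset.le_sup (Finset.mem_univ i)
        have h2 : univ.sup n ≤ t.sup fun n => univ.sup n :=
          Finset.le_sup (f := fun n : Fin l.length → ℕ => univ.sup n) hn
        omega
      refine (Finset.sum_le_sum_of_subset_of_nonneg hN fun n _ _ => hg0 n).trans ?_
      rw [hbox]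
      exact hmono.ge_of_tendsto h N
    · intro b hb
      refine le_of_tendsto' h fun N => ?_
      rw [← hbox]
      exact hb ⟨_, rfl⟩
  have := (hasSum_subtype_iff_indicator (s := s) (f := f)).2 hsum
  exact this.tsum_eq

theorem mzvL_HH (ρ : List ℕ) (h : ∀ y ∈ ρ, 1 ≤ y) (L : ℝ)
    (hL : Tendsto (fun N => HH ρ N) atTop (𝓝 L)) : mzvL ρ.reverse = L :=
  mzvL_eq _ _ (hL.congr fun N => HH_eq_GG ρ h N)

theorem Pk_lim (k : ℕ) (hk : 2 ≤ k) (F : ℕ → ℝ) (hF : F ∈ Pk k) :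
    ∃ L ∈ Submodule.span ℤ {x : ℝ | ∃ l : Composition k,
      (∀ y ∈ l.blocks, 2 ≤ y) ∧ x = mzvL l.blocks}, Tendsto F atTop (𝓝 L) := by
  induction hF using Submodule.span_induction with
  | mem F hF =>
    obtain ⟨ρ, h1, h2, rfl⟩ := hF
    cases ρ with
    | nil => simp at h2; omega
    | cons j ρ =>
      obtain ⟨L, -, hL⟩ := lim_exists j ρ (h1 j (by simp))
        (fun y hy => by have := h1 y (by simp [hy]); omega)
      refine ⟨L, Submodule.subset_span ⟨⟨(j :: ρ).reverse, ?_, ?_⟩, ?_, ?_⟩,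
        hL.comp (tendsto_add_atTop_nat 1)⟩
      · intro i hi
        have := h1 i (List.mem_reverse.1 hi)
        omega
      · rw [List.sum_reverse]; exact h2
      · intro y hy
        exact h1 y (List.mem_reverse.1 hy)
      · exact (mzvL_HH _ (fun y hy => by have := h1 y hy; omega) L hL).symm
  | zero => exact ⟨0, Submodule.zero_mem _, tendsto_const_nhds⟩
  | add F G _ _ hF hG =>
    obtain ⟨L, h1, h2⟩ := hF
    obtain ⟨L', h1', h2'⟩ := hG
    exact ⟨L + L', Submodule.add_mem _ h1 h1', h2.add h2'⟩
  | smul a F _ hF =>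
    obtain ⟨L, h1, h2⟩ := hF
    refine ⟨a • L, Submodule.smul_mem _ _ h1, ?_⟩
    exact h2.const_smul a

theorem main_mem (k : ℕ) (hk : 2 ≤ k) (κ : Composition k)
    (h : ∃ m, κ.blocks.getLast? = some m ∧ 2 ≤ m) :
    mzvL κ.blocks ∈ Submodule.span ℤ
      {x : ℝ | ∃ l : Composition k, (∀ y ∈ l.blocks, 2 ≤ y) ∧ x = mzvL l.blocks} := by
  obtain ⟨m, hm, hm2⟩ := h
  obtain ⟨l, hl⟩ := List.getLast?_eq_some_iff.1 hm
  have hpos : ∀ y ∈ m :: l.reverse, 1 ≤ y := by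
    intro y hy
    refine κ.blocks_pos (i := y) ?_
    rw [hl]
    simp at hy ⊢
    tauto
  have hrev : (m :: l.reverse).reverse = κ.blocks := by rw [hl]; simp
  obtain ⟨L, h1, h2⟩ := lim_exists m l.reverse hm2 (fun y hy => hpos y (by simp [hy]))
  have hlen : (wr (m :: l.reverse)).length = k := by
    rw [wr_length _ hpos, ← List.sum_reverse, hrev, κ.blocks_sum]
  obtain ⟨L', h3, h4⟩ := Pk_lim k hk _ (cc_mem_Pk k _ hlen (Or.inr (wr_adm m _ hm2)))
  have e := mzvL_HH _ hpos L h2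
  rw [hrev] at e
  rw [e, tendsto_nhds_unique h1 h4]
  exact h3

end MzvAux

/-- **Theorem (first main result).**
Let `k ≥ 2`.  Every multiple zeta value `ζ(κ)` of weight `k` (with `κ` admissible,
i.e. with last entry `≥ 2`) is a `ℤ`-linear combination of the values `ζ(l)` with
`l` of weight `k` and all entries `≥ 2`; in particular the `ℤ`-submodules of `ℝ`
spanned by the two families of values coincide.  Indices of weight `k` are encoded
as `Composition k` (lists of positive integers summing to `k`). -/
theorem mzv_int_comb_of_ge_two (k : ℕ) (hk : 2 ≤ k) :
    (∀ κ : Composition k, (∃ m, κ.blocks.getLast? = some m ∧ 2 ≤ m) →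
      mzvL κ.blocks ∈ Submodule.span ℤ
        {x : ℝ | ∃ l : Composition k, (∀ y ∈ l.blocks, 2 ≤ y) ∧ x = mzvL l.blocks}) ∧
    Submodule.span ℤ {x : ℝ | ∃ κ : Composition k,
        (∃ m, κ.blocks.getLast? = some m ∧ 2 ≤ m) ∧ x = mzvL κ.blocks} =
      Submodule.span ℤ {x : ℝ | ∃ l : Composition k,
        (∀ y ∈ l.blocks, 2 ≤ y) ∧ x = mzvL l.blocks} := by
  refine ⟨fun κ h => MzvAux.main_mem k hk κ h, le_antisymm ?_ ?_⟩
  · rw [Submodule.span_le]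
    rintro x ⟨κ, h, rfl⟩
    exact MzvAux.main_mem k hk κ h
  · refine Submodule.span_mono ?_
    rintro x ⟨l, h, rfl⟩
    have hne : l.blocks ≠ [] := by
      intro h0
      have := l.blocks_sum
      rw [h0] at this
      simp at this
      omega
    exact ⟨l, ⟨_, List.getLast?_eq_some_getLast hne, h _ (List.getLast_mem hne)⟩, rfl⟩
end

section
/- For every integer k ≥ 2, the dimension over ℚ of the ℚ-subspace of ℝ spanned by {ζ(κ) : κ ∈ I^adm_k} is at most F_{k−1}, the (k−1)-st Fibonacci number. -/
open scoped Classical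

namespace MZ

/-! ### words and coefficient functions; `true` is the letter x, `false` the letter y -/

def gst (l : Bool) (q : ℚ) (c : List Bool → ℚ) : List Bool → ℚ
  | [] => c []
  | a :: w => c (a :: w) + (if a = l then q * gst l q c w else 0)

def pst (l : Bool) (q : ℚ) (c : List Bool → ℚ) : List Bool → ℚ
  | [] => c []
  | a :: w => c (a :: w) + (if a = l then q * c w else 0)

def dl : List Bool → ℚ
  | [] => 1
  | _ :: _ => 0

/-- scaled coefficient functions of the product over `n = N - m, …, N - 1` -/
def cpsi (t : ℚ) (N : ℕ) : ℕ → List Bool → ℚ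
  | 0 => dl
  | m + 1 => gst false (t / ((m + 1 : ℕ) : ℚ)) (gst true (t / ((N - (m + 1) : ℕ) : ℚ)) (cpsi t N m))

def cfl (N : ℕ) : ℕ → List Bool → ℚ
  | 0 => dl
  | m + 1 => pst false (1 / ((m + 1 : ℕ) : ℚ)) (gst true (1 / ((N - (m + 1) : ℕ) : ℚ)) (cfl N m))

def Wd : ℕ → Finset (List Bool)
  | 0 => {[]}
  | d + 1 => insert [] ((Wd d).image (List.cons true) ∪ (Wd d).image (List.cons false))

lemma mem_Wd (d : ℕ) (s : List Bool) : s ∈ Wd d ↔ s.length ≤ d := by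
  induction d generalizing s with
  | zero => simp [Wd]
  | succ d ih =>
    cases s with
    | nil => simp [Wd]
    | cons a s => cases a <;> simp [Wd, ih]

lemma sum_Wd {M : Type*} [AddCommMonoid M] (d : ℕ) (f : List Bool → M) :
    ∑ s ∈ Wd (d + 1), f s = f [] + (∑ s ∈ Wd d, f (true :: s) + ∑ s ∈ Wd d, f (false :: s)) := by
  rw [Wd, Finset.sum_insert (by simp), Finset.sum_union, Finset.sum_image, Finset.sum_image]
  · intro a _ b _ h; simpa using h
  · intro a _ b _ h; simpa using h
  · rw [Finset.disjoint_left]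
    intro a ha hb
    simp only [Finset.mem_image] at ha hb
    obtain ⟨u, _, rfl⟩ := ha
    obtain ⟨v, _, h⟩ := hb
    simp at h

/-! ### matrices -/

abbrev Mt (k : ℕ) := Matrix (Fin (k + 1)) (Fin (k + 1)) ℚ

def Up {k : ℕ} (d : ℕ) (M : Mt k) : Prop := ∀ i j : Fin (k + 1), (j : ℕ) < i + d → M i j = 0

section
variable {k : ℕ}

lemma Up.add {d : ℕ} {M M' : Mt k} (h : Up d M) (h' : Up d M') : Up d (M + M') := by
  intro i j hij; simp [h i j hij, h' i j hij]

lemma Up.sub {d : ℕ} {M M' : Mt k} (h : Up d M) (h' : Up d M') : Up d (M - M') := by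
  intro i j hij; simp [h i j hij, h' i j hij]

lemma Up.neg {d : ℕ} {M : Mt k} (h : Up d M) : Up d (-M) := by
  intro i j hij; simp [h i j hij]

lemma Up.smul {d : ℕ} {M : Mt k} (q : ℚ) (h : Up d M) : Up d (q • M) := by
  intro i j hij; simp [h i j hij]

lemma Up.mono {d d' : ℕ} {M : Mt k} (h : Up d M) (hd : d' ≤ d) : Up d' M := by
  intro i j hij; exact h i j (by omega)

lemma Up.mul {a b : ℕ} {M M' : Mt k} (h : Up a M) (h' : Up b M') : Up (a + b) (M * M') := by
  intro i j hij
  rw [Matrix.mul_apply]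
  apply Finset.sum_eq_zero
  intro l _
  by_cases hl : (l : ℕ) < i + a
  · simp [h i l hl]
  · rw [h' l j (by omega), mul_zero]

lemma Up.zero (d : ℕ) : Up d (0 : Mt k) := by intro i j _; rfl

lemma Up.one : Up 0 (1 : Mt k) := by
  intro i j hij
  rw [Matrix.one_apply_ne]
  rintro rfl
  simp at hij

lemma Up.eq_zero {M : Mt k} (h : Up (k + 1) M) : M = 0 := by
  ext i j; exact h i j (by omega)

lemma Up.sum {ι : Type*} {d : ℕ} (s : Finset ι) (f : ι → Mt k) (h : ∀ i ∈ s, Up d (f i)) :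
    Up d (∑ i ∈ s, f i) := by
  induction s using Finset.induction_on with
  | empty => simpa using Up.zero d
  | insert a s ha ih =>
    rw [Finset.sum_insert ha]
    exact (h a (by simp)).add (ih fun i hi => h i (by simp [hi]))

lemma Up.pow {M : Mt k} (h : Up 1 M) (n : ℕ) : Up n (M ^ n) := by
  induction n with
  | zero => simpa using Up.one
  | succ n ih => rw [pow_succ]; exact ih.mul h

lemma Up.isUnit {M : Mt k} (h : Up 1 M) : IsUnit (1 - M) :=
  IsNilpotent.isUnit_one_sub ⟨k + 1, (h.pow (k + 1)).eq_zero⟩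

/-- inverse of `1 - M` -/
noncomputable def iv (M : Mt k) : Mt k := (1 - M)⁻¹

lemma iv_mul {M : Mt k} (h : Up 1 M) : iv M * (1 - M) = 1 :=
  Matrix.nonsing_inv_mul _ ((Matrix.isUnit_iff_isUnit_det _).1 h.isUnit)

lemma mul_iv {M : Mt k} (h : Up 1 M) : (1 - M) * iv M = 1 :=
  Matrix.mul_nonsing_inv _ ((Matrix.isUnit_iff_isUnit_det _).1 h.isUnit)

lemma iv_eq {M : Mt k} (h : Up 1 M) : iv M = ∑ i ∈ Finset.range (k + 1), M ^ i := by
  have h1 : (1 - M) * ∑ i ∈ Finset.range (k + 1), M ^ i = 1 := by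
    rw [mul_neg_geom_sum, (h.pow (k + 1)).eq_zero, sub_zero]
  calc iv M = iv M * ((1 - M) * ∑ i ∈ Finset.range (k + 1), M ^ i) := by rw [h1, mul_one]
    _ = _ := by rw [← mul_assoc, iv_mul h, one_mul]

lemma iv_up {M : Mt k} (h : Up 1 M) : Up 0 (iv M) := by
  rw [iv_eq h]
  exact Up.sum _ _ fun i _ => (h.pow i).mono (by omega)

lemma iv_sub_up {M : Mt k} (h : Up 1 M) : Up 1 (iv M - 1) := by
  have : iv M - 1 = iv M * M := by
    have := iv_mul h
    rw [mul_sub, mul_one] at this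
    rw [← this]; abel
  rw [this]
  simpa using (iv_up h).mul h

lemma iv_sub_up2 {M : Mt k} (h : Up 1 M) : Up 2 (iv M - 1 - M) := by
  have : iv M - 1 - M = (iv M - 1) * M := by
    have := iv_mul h
    rw [mul_sub, mul_one] at this
    rw [sub_mul, one_mul, ← this]; abel
  rw [this]
  exact (iv_sub_up h).mul h

/-! evaluation of words and series -/

def ev (L : Bool → Mt k) (s : List Bool) : Mt k := (s.map L).prod

noncomputable def Sm (L : Bool → Mt k) (d : ℕ) (c : List Bool → ℚ) : Mt k :=
  ∑ s ∈ Wd d, c s • ev L s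

@[simp] lemma ev_nil (L : Bool → Mt k) : ev L [] = 1 := rfl
@[simp] lemma ev_cons (L : Bool → Mt k) (a : Bool) (s : List Bool) :
    ev L (a :: s) = L a * ev L s := by simp [ev]
lemma ev_append (L : Bool → Mt k) (a s : List Bool) :
    ev L (a ++ s) = ev L a * ev L s := by simp [ev]

lemma ev_up {L : Bool → Mt k} (hL : ∀ a, Up 1 (L a)) (s : List Bool) : Up s.length (ev L s) := by
  induction s with
  | nil => exact Up.one
  | cons a s ih =>
    rw [ev_cons, List.length_cons, add_comm]; exact (hL a).mul ih

lemma Sm_succ (L : Bool → Mt k) (d : ℕ) (c : List Bool → ℚ) :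
    Sm L (d + 1) c = c [] • 1 + (L true * Sm L d (fun s => c (true :: s))
      + L false * Sm L d (fun s => c (false :: s))) := by
  simp [Sm, sum_Wd, Finset.mul_sum]

lemma Sm_add (L : Bool → Mt k) (d : ℕ) (c c' : List Bool → ℚ) :
    Sm L d (fun s => c s + c' s) = Sm L d c + Sm L d c' := by
  simp [Sm, add_smul, Finset.sum_add_distrib]

lemma Sm_smul (L : Bool → Mt k) (d : ℕ) (q : ℚ) (c : List Bool → ℚ) :
    Sm L d (fun s => q * c s) = q • Sm L d c := by
  simp [Sm, mul_smul, Finset.smul_sum]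

lemma Sm_stab_aux {L : Bool → Mt k} (hL : ∀ a, Up 1 (L a)) (d : ℕ) (c : List Bool → ℚ) :
    Up (d + 1) (Sm L (d + 1) c - Sm L d c) := by
  induction d generalizing c with
  | zero =>
    rw [Sm_succ]
    have : Sm L 0 c = c [] • 1 := by simp [Sm, Wd]
    rw [this, add_sub_cancel_left]
    have h0 : ∀ c', Up 0 (Sm L 0 c') := fun c' => by
      simp only [Sm, Wd, Finset.sum_singleton]; exact Up.one.smul _
    exact ((hL _).mul (h0 _)).add ((hL _).mul (h0 _))
  | succ d ih =>
    rw [Sm_succ L (d + 1) c, Sm_succ L d c]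
    have h1 := (hL true).mul (ih (fun s => c (true :: s)))
    have h2 := (hL false).mul (ih (fun s => c (false :: s)))
    have h3 := h1.add h2
    rw [mul_sub, mul_sub] at h3
    rw [show d + 1 + 1 = 1 + (d + 1) by ring]
    convert h3 using 1
    abel

lemma Sm_stab {L : Bool → Mt k} (hL : ∀ a, Up 1 (L a)) (c : List Bool → ℚ) :
    Sm L (k + 1) c = Sm L k c :=
  sub_eq_zero.1 (Sm_stab_aux hL k c).eq_zero

lemma Sm_pst {L : Bool → Mt k} (hL : ∀ a, Up 1 (L a)) (l : Bool) (q : ℚ) (c : List Bool → ℚ) :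
    Sm L k (pst l q c) = (1 + q • L l) * Sm L k c := by
  have h : Sm L k c = c [] • 1 + (L true * Sm L k (fun s => c (true :: s))
      + L false * Sm L k (fun s => c (false :: s))) := by rw [← Sm_succ, Sm_stab hL]
  rw [← Sm_stab hL (pst l q c), Sm_succ, add_mul, one_mul]
  conv_rhs => arg 1; rw [h]
  cases l <;> simp only [pst, Sm_add, Sm_smul, if_true, reduceCtorEq, if_false] <;>
    simp [mul_add, Sm_stab hL] <;> simp [Sm] <;> abel

lemma Sm_gst_aux {L : Bool → Mt k} (hL : ∀ a, Up 1 (L a)) (l : Bool) (q : ℚ) (c : List Bool → ℚ) :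
    Sm L k (gst l q c) = Sm L k c + q • L l * Sm L k (gst l q c) := by
  conv_lhs => rw [← Sm_stab hL (gst l q c), Sm_succ]
  conv_rhs => rw [← Sm_stab hL c, Sm_succ]
  cases l <;> simp only [gst, Sm_add, Sm_smul, if_true, reduceCtorEq, if_false] <;>
    simp [mul_add, Sm_stab hL] <;> simp [Sm] <;> abel

lemma Sm_gst {L : Bool → Mt k} (hL : ∀ a, Up 1 (L a)) (l : Bool) (q : ℚ) (c : List Bool → ℚ) :
    Sm L k (gst l q c) = iv (q • L l) * Sm L k c := by
  have h := Sm_gst_aux hL l q c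
  have h2 : (1 - q • L l) * Sm L k (gst l q c) = Sm L k c := by
    rw [sub_mul, one_mul]; nth_rewrite 1 [h]; abel
  rw [← h2, ← mul_assoc, iv_mul ((hL l).smul q), one_mul]

lemma Sm_dl (L : Bool → Mt k) (d : ℕ) : Sm L d dl = 1 := by
  cases d with
  | zero => simp [Sm, Wd, dl]
  | succ d => rw [Sm_succ]; simp [dl, Sm]

end
end MZ

namespace MZ

section
variable {k : ℕ}

/-! ### the matrices attached to a word -/

def Lw (k : ℕ) (w : List Bool) (l : Bool) : Mt k :=
  fun i j => if (j : ℕ) = i + 1 ∧ w[(i : ℕ)]? = some l then 1 else 0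

lemma Lw_up (w : List Bool) (l : Bool) : Up 1 (Lw k w l) := by
  intro i j hij
  simp only [Lw]
  rw [if_neg]
  omega

lemma Lw_mul (w : List Bool) (l : Bool) (M : Mt k) (i j : Fin (k + 1)) (h : (i : ℕ) + 1 < k + 1) :
    (Lw k w l * M) i j = if w[(i : ℕ)]? = some l then M ⟨i + 1, h⟩ j else 0 := by
  rw [Matrix.mul_apply, Finset.sum_eq_single (⟨i + 1, h⟩ : Fin (k + 1))]
  · simp [Lw]
  · intro b _ hb
    have : (b : ℕ) ≠ i + 1 := fun h' => hb (Fin.ext h')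
    simp [Lw, this]
  · simp

lemma Sm_up {L : Bool → Mt k} (hL : ∀ a, Up 1 (L a)) (d : ℕ) (c : List Bool → ℚ) :
    Up 0 (Sm L d c) :=
  Up.sum _ _ fun s _ => ((ev_up hL s).mono (by omega)).smul _

lemma Sm_entry (w : List Bool) (hw : w.length = k) (d : ℕ) (c : List Bool → ℚ) (i j : Fin (k + 1))
    (e : ℕ) (he : (j : ℕ) = i + e) (hd : e ≤ d) :
    Sm (Lw k w) d c i j = c ((w.drop i).take e) := by
  induction d generalizing c i e with
  | zero =>
    obtain rfl : e = 0 := by omega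
    obtain rfl : j = i := Fin.ext (by omega)
    simp [Sm, Wd]
  | succ d ih =>
    rw [Sm_succ]
    cases e with
    | zero =>
      obtain rfl : j = i := Fin.ext (by omega)
      have h1 := (Lw_up (k := k) w true).mul (Sm_up (Lw_up w) d (fun s => c (true :: s))) j j (by omega)
      have h2 := (Lw_up (k := k) w false).mul (Sm_up (Lw_up w) d (fun s => c (false :: s))) j j (by omega)
      simp only [Matrix.add_apply, h1, h2]
      simp
    | succ e =>
      have hi : (i : ℕ) + 1 < k + 1 := by omega
      have hij : i ≠ j := by rintro rfl; omega
      have hl : (i : ℕ) < w.length := by omega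
      simp only [Matrix.add_apply, Matrix.smul_apply, Matrix.one_apply_ne hij, smul_zero, zero_add]
      rw [Lw_mul _ _ _ _ _ hi, Lw_mul _ _ _ _ _ hi, ih _ ⟨i + 1, hi⟩ e (by simp; omega) (by omega),
        ih _ ⟨i + 1, hi⟩ e (by simp; omega) (by omega)]
      rw [List.drop_eq_getElem_cons hl, List.take_succ_cons, List.getElem?_eq_getElem hl]
      cases w[(i : ℕ)] <;> simp

lemma ev_entry (w : List Bool) (hw : w.length = k) (s : List Bool) (i j : Fin (k + 1))
    (e : ℕ) (he : (j : ℕ) = i + e) :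
    ev (Lw k w) s i j = if (w.drop i).take e = s then 1 else 0 := by
  have h : ev (Lw k w) s = Sm (Lw k w) (e + s.length) (fun u => if u = s then 1 else 0) := by
    rw [Sm, Finset.sum_eq_single s]
    · simp
    · intro b _ hb; simp [hb]
    · intro hs; exact absurd ((mem_Wd _ _).2 (by omega)) hs
  rw [h, Sm_entry w hw _ _ i j e he (by omega)]

/-! ### the twisted letters -/

lemma exists_twist {X z : Mt k} (hX : Up 1 X) (hz : Up 1 z) :
    ∃ ξ : Mt k, Up 1 ξ ∧ ξ = X + ξ * ξ + ξ * z - X * X - z * X ∧ Up 3 (ξ - X - (X * z - z * X)) := by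
  let T : Mt k → Mt k := fun ξ => X + ξ * ξ + ξ * z - X * X - z * X
  let f : ℕ → Mt k := fun n => T^[n] X
  have f0 : f 0 = X := rfl
  have fs : ∀ n, f (n + 1) = T (f n) := fun n => Function.iterate_succ_apply' T n X
  have fup : ∀ n, Up 1 (f n) := by
    intro n
    induction n with
    | zero => exact hX
    | succ n ih =>
      rw [fs]
      exact ((((hX.add ((ih.mul ih).mono (by omega))).add ((ih.mul hz).mono (by omega))).sub
        ((hX.mul hX).mono (by omega))).sub ((hz.mul hX).mono (by omega)))
  have hD : ∀ n, Up (n + 2) (f (n + 1) - f n) := by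
    intro n
    induction n with
    | zero =>
      have : f (0 + 1) - f 0 = X * z - z * X := by
        rw [fs, f0]; simp only [T]; abel
      rw [this]
      exact (hX.mul hz).sub (hz.mul hX)
    | succ n ih =>
      have : f (n + 1 + 1) - f (n + 1) = f (n + 1) * (f (n + 1) - f n) + (f (n + 1) - f n) * f n
          + (f (n + 1) - f n) * z := by
        rw [fs (n + 1)]
        conv_lhs => rhs; rw [fs n]
        simp only [T]; noncomm_ring
      rw [this]
      exact ((((fup (n + 1)).mul ih).mono (by omega)).add ((ih.mul (fup n)).mono (by omega))).add
        ((ih.mul hz).mono (by omega))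
  have h3 : ∀ n, Up 3 (f (n + 1) - X - (X * z - z * X)) := by
    intro n
    induction n with
    | zero =>
      have : f (0 + 1) - X - (X * z - z * X) = 0 := by
        rw [fs, f0]; simp only [T]; abel
      rw [this]; exact Up.zero 3
    | succ n ih =>
      have := ih.add ((hD (n + 1)).mono (show 3 ≤ n + 1 + 2 by omega))
      convert this using 1
      abel
  refine ⟨f (k + 1), fup _, ?_, h3 k⟩
  have := ((hD (k + 1)).mono (show k + 1 ≤ k + 1 + 2 by omega)).eq_zero
  rw [sub_eq_zero, fs (k + 1)] at this
  exact this.symm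

structure Tw (L L' : Bool → Mt k) : Prop where
  hL : ∀ a, Up 1 (L a)
  hL' : ∀ a, Up 1 (L' a)
  r1 : L' false - L' true = L false - L true
  r2 : L' true * L' false - L' true = L false * L true - L true
  r3 : ∀ a, Up 3 (L' a - L a - (L a * (L false - L true) - (L false - L true) * L a))

lemma exists_Tw (L : Bool → Mt k) (hL : ∀ a, Up 1 (L a)) : ∃ L', Tw L L' := by
  obtain ⟨ξ, h1, h2, h3⟩ := exists_twist (hL true) ((hL false).sub (hL true))
  refine ⟨fun a => if a = true then ξ else ξ + (L false - L true), hL, ?_, ?_, ?_, ?_⟩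
  · intro a; cases a
    · simpa using h1.add ((hL false).sub (hL true))
    · simpa using h1
  · simp
  · simp only [if_true, reduceCtorEq, if_false]
    nth_rewrite 3 [h2]
    noncomm_ring
  · intro a; cases a
    · simp only [reduceCtorEq, if_false]
      convert h3 using 1
      noncomm_ring
    · simpa using h3

lemma Tw.swap {L L' : Bool → Mt k} (h : Tw L L') (p q : ℚ) (hpq : p + q = p * q) :
    iv (q • L' false) * iv (p • L' true) = iv (p • L true) * iv (q • L false) := by
  have e : (1 - p • L' true) * (1 - q • L' false) = (1 - q • L false) * (1 - p • L true) := by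
    have h2 : L' true * L' false = L false * L true - L true + L' true := by rw [← h.r2]; abel
    have h1 : L' false = L false - L true + L' true := by rw [← h.r1]; abel
    simp only [sub_mul, mul_sub, one_mul, mul_one, smul_mul_smul_comm, h2]
    rw [h1, mul_comm q p, ← hpq]
    module
  have u1 := iv_mul ((h.hL' true).smul p)
  have u2 := iv_mul ((h.hL' false).smul q)
  have v1 := mul_iv ((h.hL true).smul p)
  have v2 := mul_iv ((h.hL false).smul q)
  have a1 : (iv (q • L' false) * iv (p • L' true)) * ((1 - p • L' true) * (1 - q • L' false)) = 1 := by
    rw [mul_assoc, ← mul_assoc (iv (p • L' true)), u1, one_mul, u2]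
  have a2 : ((1 - q • L false) * (1 - p • L true)) * (iv (p • L true) * iv (q • L false)) = 1 := by
    rw [mul_assoc, ← mul_assoc (1 - p • L true), v1, one_mul, v2]
  rw [e] at a1
  exact left_inv_eq_right_inv a1 a2

lemma Tw.left {L L' : Bool → Mt k} (h : Tw L L') :
    iv (L false) * L' true = L true * iv (L' false) := by
  have e : (1 - L false) * L true = L' true * (1 - L' false) := by
    have h2 : L' true * L' false = L false * L true - L true + L' true := by rw [← h.r2]; abel
    rw [sub_mul, mul_sub, h2]; noncomm_ring
  calc iv (L false) * L' true = iv (L false) * (L' true * (1 - L' false)) * iv (L' false) := by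
        rw [mul_assoc, mul_assoc, mul_iv (h.hL' false), mul_one]
    _ = _ := by rw [← e, ← mul_assoc, iv_mul (h.hL false), one_mul]

lemma Tw.right {L L' : Bool → Mt k} (h : Tw L L') :
    L' false * iv (L true) = iv (L' true) * L false := by
  have e : (1 - L' true) * L' false = L false * (1 - L true) := by
    have h2 : L' true * L' false = L false * L true - L true + L' true := by rw [← h.r2]; abel
    have h1 : L' false = L false - L true + L' true := by rw [← h.r1]; abel
    rw [sub_mul, mul_sub, h2, h1]; noncomm_ring
  calc L' false * iv (L true) = iv (L' true) * ((1 - L' true) * L' false) * iv (L true) := by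
        rw [← mul_assoc, iv_mul (h.hL' true), one_mul]
    _ = _ := by rw [e, mul_assoc, mul_assoc, mul_iv (h.hL true), mul_one]

lemma Tw.ev_up {L L' : Bool → Mt k} (h : Tw L L') (s : List Bool) :
    Up (s.length + 2) (ev L' s - ev L s
      - (ev L s * (L false - L true) - (L false - L true) * ev L s)) := by
  induction s with
  | nil => 
    simp only [ev_nil]
    convert Up.zero _ using 1
    noncomm_ring
  | cons a s ih =>
    have hz : Up 1 (L false - L true) := (h.hL false).sub (h.hL true)
    have hE := MZ.ev_up h.hL s
    have hE' := MZ.ev_up h.hL' s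
    have h3 := h.r3 a
    have hA := h.hL a
    set z := L false - L true
    have t1 := (hA.mul ih).mono (show (a :: s).length + 2 ≤ _ by simp; omega)
    have t2 := (((hA.mul hz).sub (hz.mul hA)).mul
      ((((hE.mul hz).mono le_rfl).sub ((hz.mul hE).mono (by omega))).add (ih.mono (by omega)))).mono
      (show (a :: s).length + 2 ≤ _ by simp; omega)
    have t3 := (h3.mul hE').mono (show (a :: s).length + 2 ≤ _ by simp; omega)
    convert (t1.add t2).add t3 using 1
    simp only [ev_cons]
    noncomm_ring

lemma Tw.ev_up2 {L L' : Bool → Mt k} (h : Tw L L') (s : List Bool) :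
    Up (s.length + 2) (iv (L false) * ev L' s * iv (L true) - ev L s
      - (ev L s * L false + L true * ev L s)) := by
  have hE := MZ.ev_up h.hL s
  have hE' := MZ.ev_up h.hL' s
  have h0 := h.ev_up s
  have hz : Up 1 (L false - L true) := (h.hL false).sub (h.hL true)
  have hd : Up (s.length + 1) (ev L' s - ev L s) := by
    have := (h0.mono (show s.length + 1 ≤ _ by omega)).add
      ((hE.mul hz).sub ((hz.mul hE).mono (show s.length + 1 ≤ _ by omega)))
    convert this using 1
    abel
  have a1 := iv_sub_up (h.hL false)
  have a2 := iv_sub_up2 (h.hL false)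
  have b1 := iv_sub_up (h.hL true)
  have b2 := iv_sub_up2 (h.hL true)
  have t1 := ((a1.mul hE').mul b1).mono (show s.length + 2 ≤ _ by omega)
  have t2 := (a2.mul hE').mono (show s.length + 2 ≤ _ by omega)
  have t3 := (hE'.mul b2).mono (show s.length + 2 ≤ _ by omega)
  have t4 := ((h.hL false).mul hd).mono (show s.length + 2 ≤ _ by omega)
  have t5 := (hd.mul (h.hL true)).mono (show s.length + 2 ≤ _ by omega)
  convert ((((h0.add t1).add t2).add t3).add t4).add t5 using 1
  generalize ev L' s = E'
  generalize ev L s = E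
  generalize iv (L false) = P
  generalize iv (L true) = Q
  noncomm_ring

lemma gst_scale (l : Bool) (t q : ℚ) (c : List Bool → ℚ) (s : List Bool) :
    gst l (t * q) (fun s => t ^ s.length * c s) s = t ^ s.length * gst l q c s := by
  induction s with
  | nil => simp [gst]
  | cons a s ih =>
    simp only [gst, ih, List.length_cons]
    split_ifs <;> ring

lemma cpsi_scale (t : ℚ) (N m : ℕ) (s : List Bool) :
    cpsi t N m s = t ^ s.length * cpsi 1 N m s := by
  induction m generalizing s with
  | zero => cases s <;> simp [cpsi, dl]
  | succ m ih =>
    simp only [cpsi]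
    rw [← gst_scale, mul_one_div]
    congr 1
    funext u
    rw [← gst_scale, mul_one_div]
    congr 1
    funext v
    exact ih v

lemma Tw.main {L L' : Bool → Mt k} (h : Tw L L') (N m : ℕ) (hm : m + 1 ≤ N) :
    Sm L k (cpsi N (N + 1) (m + 1)) = iv (((N : ℚ) / ((m + 1 : ℕ) : ℚ)) • L false)
      * Sm L' k (cpsi N N m) * iv (L true) := by
  induction m with
  | zero =>
    simp only [cpsi]
    rw [Sm_gst h.hL, Sm_gst h.hL, Sm_dl, Sm_dl, mul_one, mul_one]
    have : (N : ℚ) ≠ 0 := by norm_cast; omega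
    simp [div_self this]
  | succ m ih =>
    rw [cpsi, Sm_gst h.hL, Sm_gst h.hL, ih (by omega)]
    rw [cpsi, Sm_gst h.hL', Sm_gst h.hL']
    obtain ⟨n, rfl⟩ : ∃ n, N = n + (m + 1) := ⟨N - (m + 1), by omega⟩
    rw [show n + (m + 1) + 1 - (m + 1 + 1) = n by omega, show n + (m + 1) - (m + 1) = n by omega]
    have hs := h.swap (((n + (m + 1) : ℕ) : ℚ) / (n : ℚ)) (((n + (m + 1) : ℕ) : ℚ) / ((m + 1 : ℕ) : ℚ)) (by
      have : (n : ℚ) ≠ 0 := by norm_cast; omega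
      have : ((m + 1 : ℕ) : ℚ) ≠ 0 := by norm_cast
      push_cast at *
      field_simp
      ring)
    simp only [← mul_assoc]
    rw [mul_assoc (iv ((((n + (m + 1) : ℕ) : ℚ) / ((m + 1 + 1 : ℕ) : ℚ)) • L false)) (iv _), ← hs]
    simp only [mul_assoc]

def psi (N : ℕ) (s : List Bool) : ℚ := cpsi 1 N (N - 1) s

/-- admissible words -/
def Ad (s : List Bool) : Prop := s.head? = some false ∧ s.getLast? = some true

lemma psi_rec (k : ℕ) (w : List Bool) (hw : w.length = k) (had : Ad w) :
    ∃ κ : List Bool → ℚ, ∀ N : ℕ, 1 ≤ N → psi (N + 1) w = psi N w +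
      ∑ s ∈ (Wd k).filter (fun s => s.length + 2 ≤ k ∧ (s = [] ∨ Ad s)),
        κ s * (1 / (N : ℚ) ^ (k - s.length) * psi N s) := by
  obtain ⟨L', h⟩ := exists_Tw (Lw k w) (Lw_up w)
  have hk : 2 ≤ k := by
    obtain ⟨h1, h2⟩ := had
    subst hw
    match w, h1, h2 with
    | [a], h1, h2 => simp at h1 h2; simp [h1] at h2
    | a :: b :: w, h1, h2 => simp
  have hw0 : w[0]? = some false := by rw [← List.head?_eq_getElem?]; exact had.1
  have hw1 : w[k - 1]? = some true := by
    rw [← hw, ← List.getLast?_eq_getElem?]; exact had.2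
  set κ : List Bool → ℚ := fun s =>
    (iv (Lw k w false) * ev L' s * iv (Lw k w true)) 0 (Fin.last k) with hκ
  have rowX : ∀ M : Mt k, (Lw k w true * M) 0 (Fin.last k) = 0 := by
    intro M
    rw [Lw_mul _ _ _ _ _ (by simp; omega)]
    simp [hw0]
  have colY : ∀ M : Mt k, (M * Lw k w false) 0 (Fin.last k) = 0 := by
    intro M
    rw [Matrix.mul_apply]
    apply Finset.sum_eq_zero
    intro i _
    simp only [Lw, Fin.val_last]
    rw [if_neg, mul_zero]
    rintro ⟨h1, h2⟩
    rw [show (i : ℕ) = k - 1 by omega, hw1] at h2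
    simp at h2
  have κx : ∀ s, κ (true :: s) = 0 := by
    intro s
    simp only [hκ, ev_cons]
    rw [← mul_assoc, h.left, mul_assoc, mul_assoc, rowX]
  have κy : ∀ s, κ (s ++ [false]) = 0 := by
    intro s
    simp only [hκ, ev_append, ev_cons, ev_nil, mul_one]
    rw [mul_assoc, mul_assoc, h.right, ← mul_assoc, ← mul_assoc, colY]
  have κad : ∀ s, ¬ (s = [] ∨ Ad s) → κ s = 0 := by
    intro s hs
    push Not at hs
    obtain ⟨h1, h2⟩ := hs
    obtain ⟨a, u, rfl⟩ := List.exists_cons_of_ne_nil h1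
    cases a with
    | true => exact κx u
    | false =>
      rcases List.eq_nil_or_concat (false :: u) with h3 | ⟨v, b, h3⟩
      · simp at h3
      · rw [List.concat_eq_append] at h3
        cases b with
        | false => rw [h3]; exact κy v
        | true =>
          exfalso; apply h2
          refine ⟨by simp, ?_⟩
          rw [h3]; simp
  have κev : ∀ s, k ≤ s.length + 1 → κ s = ev (Lw k w) s 0 (Fin.last k) := by
    intro s hs
    have := h.ev_up2 s 0 (Fin.last k) (by simp; omega)
    simp only [Matrix.sub_apply, Matrix.add_apply, rowX, colY] at this
    simp only [hκ]
    linarith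
  have κtop : ∀ s, k ≤ s.length + 1 → κ s = if s = w then 1 else 0 := by
    intro s hs
    rw [κev s hs, ev_entry w hw s 0 (Fin.last k) k (by simp)]
    simp only [Fin.val_zero, List.drop_zero]
    rw [List.take_of_length_le (by omega)]
    simp [eq_comm]
  refine ⟨κ, fun N hN => ?_⟩
  have hN0 : (N : ℚ) ≠ 0 := by norm_cast; omega
  have e := h.main N (N - 1) (by omega)
  rw [show N - 1 + 1 = N by omega, div_self hN0, one_smul] at e
  have e2 := congrFun (congrFun e 0) (Fin.last k)
  rw [Sm_entry w hw k _ 0 (Fin.last k) k (by simp) le_rfl] at e2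
  simp only [Fin.val_zero, List.drop_zero] at e2
  rw [List.take_of_length_le (by omega)] at e2
  have e3 : (iv (Lw k w false) * Sm L' k (cpsi N N (N - 1)) * iv (Lw k w true)) 0 (Fin.last k)
      = ∑ s ∈ Wd k, (N : ℚ) ^ s.length * psi N s * κ s := by
    rw [Sm, Finset.mul_sum, Finset.sum_mul, Matrix.sum_apply]
    apply Finset.sum_congr rfl
    intro s _
    rw [cpsi_scale, mul_smul_comm, smul_mul_assoc, Matrix.smul_apply, smul_eq_mul]
    rfl
  rw [e3, cpsi_scale, hw] at e2
  have e4 : ∑ s ∈ Wd k, (N : ℚ) ^ s.length * psi N s * κ s = (N : ℚ) ^ k * psi N w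
      + ∑ s ∈ (Wd k).filter (fun s => s.length + 2 ≤ k ∧ (s = [] ∨ Ad s)),
        (N : ℚ) ^ s.length * psi N s * κ s := by
    rw [← Finset.sum_filter_add_sum_filter_not (Wd k)
      (fun s => s.length + 2 ≤ k ∧ (s = [] ∨ Ad s)), add_comm]
    congr 1
    rw [Finset.sum_eq_single w]
    · rw [κtop w (by omega), hw]; simp
    · intro s hs hsw
      rw [Finset.mem_filter] at hs
      by_cases h1 : s.length + 2 ≤ k
      · rw [κad s (by tauto), mul_zero]
      · rw [κtop s (by omega), if_neg hsw, mul_zero]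
    · intro hs
      exfalso; apply hs
      rw [Finset.mem_filter, mem_Wd]
      exact ⟨hw.le, by omega⟩
  rw [e4] at e2
  have hpsi : cpsi 1 (N + 1) N w = psi (N + 1) w := rfl
  rw [hpsi] at e2
  have hNk : (N : ℚ) ^ k ≠ 0 := pow_ne_zero _ hN0
  apply mul_left_cancel₀ hNk
  rw [e2, mul_add, Finset.mul_sum]
  congr 1
  apply Finset.sum_congr rfl
  intro s hs
  rw [Finset.mem_filter] at hs
  have : (N : ℚ) ^ k = (N : ℚ) ^ s.length * (N : ℚ) ^ (k - s.length) := by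
    rw [← pow_add]; congr 1; omega
  rw [this]
  have : (N : ℚ) ^ (k - s.length) ≠ 0 := pow_ne_zero _ hN0
  field_simp

end
end MZ

namespace MZ

/-! ### truncated sums and the spanning set -/

/-- truncated multiple harmonic sums, largest variable first -/
def zrec : List ℕ → ℕ → ℚ
  | [], _ => 1
  | k :: ks, N => ∑ n ∈ Finset.Ico 1 N, 1 / (n : ℚ) ^ k * zrec ks n

def inc : List ℕ → List ℕ
  | [] => []
  | a :: l => (a + 1) :: l

def G : ℕ → Finset (List ℕ)
  | 0 => {[]}
  | 1 => ∅
  | k + 2 => (G (k + 1)).image inc ∪ (G k).image (List.cons 2)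

lemma G_card (k : ℕ) : (G (k + 2)).card ≤ Nat.fib (k + 1) := by
  induction k using Nat.twoStepInduction with
  | zero => simp [G]
  | one => simp [G]
  | more k h1 h2 =>
    rw [G]
    refine (Finset.card_union_le _ _).trans ?_
    have e : Nat.fib (k + 2 + 1) = Nat.fib (k + 1) + Nat.fib (k + 1 + 1) := Nat.fib_add_two
    rw [e, add_comm]
    exact add_le_add (Finset.card_image_le.trans h1) (Finset.card_image_le.trans h2)

lemma G_cons (i j : ℕ) (ks : List ℕ) (h : ks ∈ G j) : (i + 2) :: ks ∈ G (j + (i + 2)) := by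
  induction i with
  | zero =>
    simp only [G]
    exact Finset.mem_union_right _ (Finset.mem_image_of_mem _ h)
  | succ i ih =>
    have : j + (i + 1 + 2) = (j + i + 1) + 2 := by ring
    rw [this, G]
    refine Finset.mem_union_left _ (Finset.mem_image.2 ⟨(i + 2) :: ks, ?_, rfl⟩)
    convert ih using 2
    omega

lemma G_two (k : ℕ) : ∀ ks ∈ G k, ∀ a ∈ ks, 2 ≤ a := by
  induction k using Nat.twoStepInduction with
  | zero => simp [G]
  | one => simp [G]
  | more k h1 h2 =>
    intro ks hks
    simp only [G, Finset.mem_union, Finset.mem_image] at hks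
    rcases hks with ⟨l, hl, rfl⟩ | ⟨l, hl, rfl⟩
    · cases l with
      | nil => simp [inc]
      | cons b l =>
        have := h2 _ hl
        simp only [inc, List.mem_cons, forall_eq_or_imp] at this ⊢
        exact ⟨by omega, this.2⟩
    · have := h1 _ hl
      simp only [List.mem_cons, forall_eq_or_imp]
      exact ⟨le_rfl, this⟩

noncomputable def V (k : ℕ) : Submodule ℚ (ℕ → ℚ) := Submodule.span ℚ (zrec '' (G k : Set (List ℕ)))

def Sg (i : ℕ) : (ℕ → ℚ) →ₗ[ℚ] (ℕ → ℚ) where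
  toFun f := fun N => ∑ n ∈ Finset.Ico 1 N, 1 / (n : ℚ) ^ i * f n
  map_add' f g := by
    funext N; simp [mul_add, Finset.sum_add_distrib]
  map_smul' c f := by
    funext N; simp only [Pi.smul_apply, smul_eq_mul, RingHom.id_apply, Finset.mul_sum]
    exact Finset.sum_congr rfl fun n _ => by ring

lemma Sg_mem (i j : ℕ) (hi : 2 ≤ i) (f : ℕ → ℚ) (hf : f ∈ V j) : Sg i f ∈ V (j + i) := by
  obtain ⟨i, rfl⟩ : ∃ i', i = i' + 2 := ⟨i - 2, by omega⟩
  have : V j ≤ (V (j + (i + 2))).comap (Sg (i + 2)) := by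
    rw [V, Submodule.span_le]
    rintro _ ⟨ks, hks, rfl⟩
    exact Submodule.subset_span ⟨(i + 2) :: ks, G_cons i j ks hks, rfl⟩
  exact this hf

lemma gst_nil (l : Bool) (q : ℚ) (c : List Bool → ℚ) : gst l q c [] = c [] := rfl

lemma cpsi_nil (t : ℚ) (N m : ℕ) : cpsi t N m [] = 1 := by
  induction m with
  | zero => rfl
  | succ m ih => simp [cpsi, gst_nil, ih]

lemma telesc (f g : ℕ → ℚ) (h0 : f 0 = 0) (h1 : f 1 = 0) (h : ∀ N, 1 ≤ N → f (N + 1) = f N + g N) (N : ℕ) :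
    f N = ∑ n ∈ Finset.Ico 1 N, g n := by
  induction N with
  | zero => simp [h0]
  | succ N ih =>
    rcases Nat.eq_zero_or_pos N with rfl | hN
    · simp [h1]
    · rw [h N hN, Finset.sum_Ico_succ_top hN, ih]

lemma psi_mem (k : ℕ) (w : List Bool) (hw : w.length = k) (h : w = [] ∨ Ad w) :
    (fun N => psi N w) ∈ V k := by
  induction k using Nat.strong_induction_on generalizing w with
  | _ k ih =>
    rcases h with rfl | had
    · obtain rfl : k = 0 := by simpa using hw.symm
      apply Submodule.subset_span
      refine ⟨[], by simp [G], ?_⟩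
      funext N
      simp [zrec, psi, cpsi_nil]
    · obtain ⟨κ, hκ⟩ := psi_rec k w hw had
      have hne : w ≠ [] := by rintro rfl; simp [Ad] at had
      have hdl : dl w = 0 := by
        cases w with
        | nil => exact absurd rfl hne
        | cons a w => rfl
      have e : (fun N => psi N w) = ∑ s ∈ (Wd k).filter (fun s => s.length + 2 ≤ k ∧ (s = [] ∨ Ad s)),
          κ s • Sg (k - s.length) (fun N => psi N s) := by
        funext N
        rw [telesc (fun N => psi N w) _ hdl hdl hκ N, Finset.sum_comm, Finset.sum_apply]
        apply Finset.sum_congr rfl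
        intro s _
        simp [Sg, Finset.mul_sum]
      rw [e]
      apply Submodule.sum_mem
      intro s hs
      rw [Finset.mem_filter] at hs
      apply Submodule.smul_mem
      have := Sg_mem (k - s.length) s.length (by omega) _ (ih s.length (by omega) s rfl hs.2.2)
      rwa [show s.length + (k - s.length) = k by omega] at this

/-! ### the discretised iterated integral equals the truncated sum -/

section
variable {k : ℕ}

lemma iv_comm_aux (X Y : Mt k) (hX : Up 1 X) (n m : ℕ) (hn : n ≠ 0) (hm : m ≠ 0) :
    (((n + m : ℕ) : ℚ) • (1 : Mt k) - X + Y) * (iv ((1 / (n : ℚ)) • X) * (1 + (1 / (m : ℚ)) • Y))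
      = (1 + (1 / (m : ℚ)) • Y) * iv ((1 / (n : ℚ)) • X) * (((n + m : ℕ) : ℚ) • (1 : Mt k) - X + Y) := by
  have hn' : (n : ℚ) ≠ 0 := by exact_mod_cast hn
  have hm' : (m : ℚ) ≠ 0 := by exact_mod_cast hm
  have e : ((n + m : ℕ) : ℚ) • (1 : Mt k) - X + Y
      = (n : ℚ) • (1 - (1 / (n : ℚ)) • X) + (m : ℚ) • (1 + (1 / (m : ℚ)) • Y) := by
    rw [smul_sub, smul_add, smul_smul, smul_smul, mul_one_div_cancel hn', mul_one_div_cancel hm']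
    push_cast
    rw [add_smul]; module
  have u1 := iv_mul (hX.smul (1 / (n : ℚ)))
  have u2 := mul_iv (hX.smul (1 / (n : ℚ)))
  rw [e]
  generalize iv ((1 / (n : ℚ)) • X) = A at *
  generalize (1 - (1 / (n : ℚ)) • X) = B at *
  generalize (1 + (1 / (m : ℚ)) • Y) = C at *
  rw [add_mul, mul_add, smul_mul_assoc, smul_mul_assoc, ← mul_assoc, u2, mul_smul_comm, mul_smul_comm,
    mul_assoc C A B, u1, mul_one, one_mul, mul_assoc C A C]

noncomputable def Zm (X Y : Mt k) (N : ℕ) : ℕ → Mt k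
  | 0 => 1
  | m + 1 => iv ((1 / ((N - (m + 1) : ℕ) : ℚ)) • X) * (1 + (1 / ((m + 1 : ℕ) : ℚ)) • Y) * Zm X Y N m

lemma cfl_a (L : Bool → Mt k) (hL : ∀ a, Up 1 (L a)) (N m : ℕ) (hm : m < N) :
    ((N : ℚ) • (1 : Mt k) - L true + L false) * Zm (L true) (L false) N m
      = Sm L k (cfl N m) * ((N : ℚ) • (1 : Mt k) - L true + L false) := by
  induction m with
  | zero => simp [Zm, cfl, Sm_dl]
  | succ m ih =>
    have := iv_comm_aux (L true) (L false) (hL true) (N - (m + 1)) (m + 1) (by omega) (by omega)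
    rw [show N - (m + 1) + (m + 1) = N by omega] at this
    rw [Zm, ← mul_assoc, this, mul_assoc, ih (by omega), cfl, Sm_pst hL, Sm_gst hL]
    simp only [mul_assoc]

lemma cfl_b (L : Bool → Mt k) (hL : ∀ a, Up 1 (L a)) (N m : ℕ) :
    Sm L k (cfl (N + 1) (m + 1)) = (1 + (1 / ((m + 1 : ℕ) : ℚ)) • L false)
      * Zm (L true) (L false) N m * iv ((1 / (N : ℚ)) • L true) := by
  induction m with
  | zero => simp [Zm, cfl, Sm_pst hL, Sm_gst hL, Sm_dl]
  | succ m ih =>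
    rw [cfl, Sm_pst hL, Sm_gst hL, ih, Zm]
    rw [show N + 1 - (m + 1 + 1) = N - (m + 1) by omega]
    simp only [mul_assoc]

lemma cfl_c (L : Bool → Mt k) (hL : ∀ a, Up 1 (L a)) (N : ℕ) (hN : 1 ≤ N) :
    Sm L k (cfl (N + 1) N) * ((N : ℚ) • (1 : Mt k) - L true)
      = Sm L k (cfl N (N - 1)) * ((N : ℚ) • (1 : Mt k) - L true + L false)
        + L true * Zm (L true) (L false) N (N - 1) := by
  have hN0 : (N : ℚ) ≠ 0 := by norm_cast; omega
  have b := cfl_b L hL N (N - 1)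
  have a := cfl_a L hL N (N - 1) (by omega)
  rw [show N - 1 + 1 = N by omega] at b
  rw [← a, b]
  have e : (N : ℚ) • (1 : Mt k) - L true = (N : ℚ) • (1 - (1 / (N : ℚ)) • L true) := by
    rw [smul_sub, smul_smul, mul_one_div_cancel hN0, one_smul]
  have e2 : (N : ℚ) • (1 + (1 / (N : ℚ)) • L false) = (N : ℚ) • (1 : Mt k) + L false := by
    rw [smul_add, smul_smul, mul_one_div_cancel hN0, one_smul]
  rw [e, mul_smul_comm, mul_assoc _ (iv _), iv_mul ((hL true).smul _), mul_one, ← smul_mul_assoc, e2,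
    ← e, ← add_mul]
  congr 1
  abel

end

def K (N : ℕ) (w : List Bool) : ℚ := cfl N (N - 1) w

lemma mul_Lw_last (u : List Bool) (a l : Bool) (M : Mt (u.length + 1)) :
    (M * Lw (u.length + 1) (u ++ [a]) l) 0 (Fin.last (u.length + 1))
      = if a = l then M 0 ⟨u.length, by omega⟩ else 0 := by
  rw [Matrix.mul_apply, Finset.sum_eq_single (⟨u.length, by omega⟩ : Fin (u.length + 1 + 1))]
  · simp [Lw]
  · intro b _ hb
    have : (b : ℕ) ≠ u.length := fun h => hb (Fin.ext h)
    simp only [Lw, Fin.val_last]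
    rw [if_neg, mul_zero]
    omega
  · simp

lemma K_rec (u : List Bool) (a : Bool) (h : (u ++ [a]).head? = some false) (N : ℕ) (hN : 1 ≤ N) :
    N * K (N + 1) (u ++ [a]) - (if a = true then K (N + 1) u else 0)
      = N * K N (u ++ [a]) - (if a = true then K N u else 0) + (if a = false then K N u else 0) := by
  have e := cfl_c (Lw (u.length + 1) (u ++ [a])) (Lw_up _) N hN
  have hw : (u ++ [a]).length = u.length + 1 := by simp
  have e1 := congrFun (congrFun e 0) (Fin.last (u.length + 1))
  have hw0 : (u ++ [a])[0]? = some false := by rw [← List.head?_eq_getElem?]; exact h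
  have rowX : ∀ M : Mt (u.length + 1), (Lw (u.length + 1) (u ++ [a]) true * M) 0 (Fin.last _) = 0 := by
    intro M
    rw [Lw_mul _ _ _ _ _ (by simp)]
    simp only [Fin.val_zero, hw0]; simp
  have full : ∀ c, Sm (Lw (u.length + 1) (u ++ [a])) (u.length + 1) c 0 (Fin.last (u.length + 1))
      = c (u ++ [a]) := by
    intro c
    rw [Sm_entry _ hw _ _ _ _ (u.length + 1) (by simp) le_rfl]
    simp only [Fin.val_zero, List.drop_zero]
    rw [List.take_of_length_le (by omega)]
  have part : ∀ c, Sm (Lw (u.length + 1) (u ++ [a])) (u.length + 1) c 0 ⟨u.length, by omega⟩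
      = c u := by
    intro c
    rw [Sm_entry _ hw _ _ _ _ u.length (by simp) (by omega)]
    simp
  simp only [mul_add, mul_sub, Matrix.add_apply, Matrix.sub_apply, mul_Lw_last, rowX,
    mul_smul_comm, mul_one, Matrix.smul_apply, full, part, smul_eq_mul, add_zero] at e1
  exact e1

lemma K_block (u : List Bool) (h : u = [] ∨ u.head? = some false) (j N : ℕ) (hN : 1 ≤ N) :
    K (N + 1) (u ++ false :: List.replicate j true) = K N (u ++ false :: List.replicate j true)
      + 1 / (N : ℚ) ^ (j + 1) * K N u := by
  have hN0 : (N : ℚ) ≠ 0 := by norm_cast; omega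
  have hh : ∀ v, (u ++ false :: v).head? = some false := by
    intro v
    rcases h with rfl | h
    · simp
    · simp [h]
  induction j with
  | zero =>
    have := K_rec u false (by simpa using hh []) N hN
    simp only [reduceCtorEq, if_false, if_true, sub_zero] at this
    simp only [List.replicate_zero, zero_add, pow_one]
    field_simp
    linarith
  | succ j ih =>
    have := K_rec (u ++ false :: List.replicate j true) true
      (by rw [List.append_assoc]; exact hh _) N hN
    simp only [reduceCtorEq, if_false, if_true, add_zero] at this
    have e : u ++ false :: List.replicate (j + 1) true
        = u ++ false :: List.replicate j true ++ [true] := by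
      rw [List.replicate_succ']; simp
    rw [ih] at this
    rw [e]
    apply mul_left_cancel₀ hN0
    have e2 : (N : ℚ) * (1 / (N : ℚ) ^ (j + 1 + 1) * K N u) = 1 / (N : ℚ) ^ (j + 1) * K N u := by
      field_simp
      ring
    rw [mul_add, e2]
    linarith

def word : List ℕ → List Bool
  | [] => []
  | k :: ks => word ks ++ false :: List.replicate (k - 1) true

lemma word_head (ks : List ℕ) : word ks = [] ∨ (word ks).head? = some false := by
  induction ks with
  | nil => simp [word]
  | cons k ks ih =>
    right
    rcases ih with h | h
    · simp [word, h]
    · simp [word, h]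

lemma word_length (ks : List ℕ) (h : ∀ a ∈ ks, 1 ≤ a) : (word ks).length = ks.sum := by
  induction ks with
  | nil => simp [word]
  | cons k ks ih =>
    simp only [List.mem_cons, forall_eq_or_imp] at h
    simp [word, ih h.2]
    omega

lemma word_ad (k : ℕ) (ks : List ℕ) (h : 2 ≤ k) : Ad (word (k :: ks)) := by
  refine ⟨?_, ?_⟩
  · rcases word_head (k :: ks) with h | h
    · simp [word] at h
    · exact h
  · obtain ⟨j, rfl⟩ : ∃ j, k = j + 2 := ⟨k - 2, by omega⟩
    rw [word, show j + 2 - 1 = j + 1 by omega, List.replicate_succ']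
    rw [← List.cons_append, ← List.append_assoc]
    exact List.getLast?_concat

lemma K_word (ks : List ℕ) (h : ∀ a ∈ ks, 1 ≤ a) (N : ℕ) : K N (word ks) = zrec ks N := by
  induction ks generalizing N with
  | nil =>
    have : ∀ m, cfl N m [] = 1 := by
      intro m
      induction m with
      | zero => rfl
      | succ m ih => simp [cfl, gst, pst, ih]
    simp [K, word, zrec, this]
  | cons k ks ih =>
    simp only [List.mem_cons, forall_eq_or_imp] at h
    have hdl : dl (word (k :: ks)) = 0 := by
      rw [word]
      cases word ks <;> rfl
    rw [telesc (fun N => K N (word (k :: ks))) (fun n => 1 / (n : ℚ) ^ k * K n (word ks)) hdl hdl ?_ N,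
      zrec]
    · exact Finset.sum_congr rfl fun n _ => by rw [ih h.2]
    · intro N hN
      have := K_block (word ks) (word_head ks) (k - 1) N hN
      rw [show k - 1 + 1 = k by omega] at this
      exact this

end MZ

namespace MZ

/-! ### comparison of the two discretisations -/

/-- empty words and words ending in x -/
def Pw (w : List Bool) : Prop := w.getLast? ≠ some false

lemma Pw.tail {a : Bool} {w : List Bool} (h : Pw (a :: w)) : Pw w := by
  cases w with
  | nil => simp [Pw]
  | cons b w => simpa [Pw, List.getLast?_cons_cons] using h

lemma gst_nonneg (l : Bool) (q : ℚ) (hq : 0 ≤ q) (c : List Bool → ℚ) (hc : ∀ w, 0 ≤ c w) (w : List Bool) :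
    0 ≤ gst l q c w := by
  induction w with
  | nil => exact hc []
  | cons a w ih =>
    simp only [gst]
    have := hc (a :: w)
    split_ifs
    · positivity
    · simpa using this

lemma gst_nonneg' (l : Bool) (q : ℚ) (hq : 0 ≤ q) (c : List Bool → ℚ) (hc : ∀ w, Pw w → 0 ≤ c w)
    (w : List Bool) (hw : Pw w) : 0 ≤ gst l q c w := by
  induction w with
  | nil => exact hc [] hw
  | cons a w ih =>
    simp only [gst]
    have := hc (a :: w) hw
    have := ih hw.tail
    split_ifs
    · positivity
    · simpa

lemma gst_sub (l : Bool) (q : ℚ) (c c' : List Bool → ℚ) (w : List Bool) :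
    gst l q (fun w => c w - c' w) w = gst l q c w - gst l q c' w := by
  induction w with
  | nil => rfl
  | cons a w ih =>
    simp only [gst, ih]
    split_ifs <;> ring

lemma step_ineq (B σ q : ℚ) (hB : 0 ≤ B) (hσ : 0 ≤ σ) (hq : 0 ≤ q) (n : ℕ) :
    B * σ ^ (n + 1) + q * (B * (σ + q) ^ n) ≤ B * (σ + q) ^ (n + 1) := by
  have : σ ^ n ≤ (σ + q) ^ n := pow_le_pow_left₀ hσ (by linarith) n
  have h2 : B * σ * σ ^ n ≤ B * σ * (σ + q) ^ n := mul_le_mul_of_nonneg_left this (by positivity)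
  rw [pow_succ, pow_succ]
  nlinarith

lemma gst_le (l : Bool) (B σ q : ℚ) (hB : 0 ≤ B) (hσ : 0 ≤ σ) (hq : 0 ≤ q) (c : List Bool → ℚ)
    (hc : ∀ w, Pw w → c w ≤ B * σ ^ w.length) (w : List Bool) (hw : Pw w) :
    gst l q c w ≤ B * (σ + q) ^ w.length := by
  induction w with
  | nil => simpa [gst_nil] using hc [] hw
  | cons a w ih =>
    have h1 := hc (a :: w) hw
    have h2 := mul_le_mul_of_nonneg_left (ih hw.tail) hq
    have h3 := step_ineq B σ q hB hσ hq w.length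
    have h4 : 0 ≤ q * (B * (σ + q) ^ w.length) := by positivity
    simp only [gst, List.length_cons] at *
    split_ifs
    · linarith
    · linarith

lemma gst_le_x (l : Bool) (τ τ' σ q : ℚ) (hτ : 0 ≤ τ) (hσ : 0 ≤ σ) (hq : 0 ≤ q) (hτ' : τ ≤ τ')
    (hl : l = true → τ + q ≤ τ') (c : List Bool → ℚ) (c0 : c [] = 1)
    (hc : ∀ w, Pw w → w ≠ [] → c w ≤ τ * σ ^ (w.length - 1)) (w : List Bool) (hw : Pw w) (hw0 : w ≠ []) :
    gst l q c w ≤ τ' * (σ + q) ^ (w.length - 1) := by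
  induction w with
  | nil => exact absurd rfl hw0
  | cons a w ih =>
    have h1 := hc (a :: w) hw hw0
    cases w with
    | nil =>
      have ha : a = true := by
        cases a
        · simp [Pw] at hw
        · rfl
      subst ha
      simp only [gst, c0, List.length_cons, List.length_nil, zero_add, Nat.sub_self, pow_zero, mul_one] at *
      split_ifs with h
      · linarith [hl h.symm]
      · linarith
    | cons b w =>
      have h2 := mul_le_mul_of_nonneg_left (ih hw.tail (by simp)) hq
      have h3 := step_ineq τ' σ q (hτ.trans hτ') hσ hq w.length
      have h4 : 0 ≤ q * (τ' * (σ + q) ^ w.length) := by have := hτ.trans hτ'; positivity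
      have h5 : τ * σ ^ (w.length + 1) ≤ τ' * σ ^ (w.length + 1) :=
        mul_le_mul_of_nonneg_right hτ' (by positivity)
      rw [gst]
      simp only [List.length_cons, Nat.add_sub_cancel] at *
      split_ifs
      · linarith
      · linarith

lemma ystep (c d : List Bool → ℚ) (q ε δ σ : ℚ) (hq : 0 ≤ q) (hε : 0 ≤ ε) (hδ : 0 ≤ δ) (hσ : 0 ≤ σ)
    (h0 : ∀ w, Pw w → 0 ≤ c w - d w) (h1 : ∀ w, Pw w → c w - d w ≤ ε * (1 + σ) ^ w.length)
    (h2 : ∀ w, Pw w → w ≠ [] → 0 ≤ gst false q c w)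
    (h3 : ∀ w, Pw w → w ≠ [] → q * (q * gst false q c w) ≤ δ * (1 + σ + q) ^ w.length)
    (w : List Bool) (hw : Pw w) :
    0 ≤ gst false q c w - pst false q d w ∧
      gst false q c w - pst false q d w ≤ (ε + δ) * (1 + σ + q) ^ w.length := by
  have hm : ∀ n : ℕ, ε * (1 + σ) ^ n ≤ (ε + δ) * (1 + σ + q) ^ n := fun n =>
    mul_le_mul (by linarith) (pow_le_pow_left₀ (by linarith) (by linarith) n) (by positivity) (by positivity)
  match w, hw with
  | [], hw => exact ⟨h0 [] hw, (h1 [] hw).trans (hm 0)⟩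
  | true :: w, hw =>
    simp only [gst, pst, reduceCtorEq, if_false, add_zero]
    exact ⟨h0 _ hw, (h1 _ hw).trans (hm _)⟩
  | [false], hw => simp [Pw] at hw
  | false :: true :: w, hw =>
    have a1 := h0 _ hw
    have a2 := h1 _ hw
    have b1 := mul_nonneg hq (h0 _ hw.tail)
    have b2 := mul_le_mul_of_nonneg_left (h1 _ hw.tail) hq
    have s := step_ineq ε (1 + σ) q hε (by linarith) hq (w.length + 1)
    have t : 0 ≤ δ * (1 + σ + q) ^ (w.length + 1 + 1) := by positivity
    simp only [gst, pst, reduceCtorEq, if_false, if_true, add_zero, List.length_cons] at *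
    have s2 : q * (ε * (1 + σ) ^ (w.length + 1)) ≤ q * (ε * (1 + σ + q) ^ (w.length + 1)) := by
      have := pow_le_pow_left₀ (show 0 ≤ 1 + σ by linarith) (show 1 + σ ≤ 1 + σ + q by linarith) (w.length + 1)
      gcongr
    constructor
    · linarith
    · linarith
  | false :: false :: w, hw =>
    have hne : w ≠ [] := by rintro rfl; simp [Pw] at hw
    have a1 := h0 _ hw
    have a2 := h1 _ hw
    have b1 := mul_nonneg hq (h0 _ hw.tail)
    have b2 := mul_le_mul_of_nonneg_left (h1 _ hw.tail) hq
    have e1 := mul_nonneg hq (mul_nonneg hq (h2 _ hw.tail.tail hne))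
    have e2 := h3 _ hw.tail.tail hne
    have s := step_ineq ε (1 + σ) q hε (by linarith) hq (w.length + 1)
    have t : δ * (1 + σ + q) ^ w.length ≤ δ * (1 + σ + q) ^ (w.length + 1 + 1) := by
      gcongr
      · linarith
      · omega
    simp only [gst, pst, reduceCtorEq, if_false, if_true, add_zero, List.length_cons] at *
    have s2 : q * (ε * (1 + σ) ^ (w.length + 1)) ≤ q * (ε * (1 + σ + q) ^ (w.length + 1)) := by
      have := pow_le_pow_left₀ (show 0 ≤ 1 + σ by linarith) (show 1 + σ ≤ 1 + σ + q by linarith) (w.length + 1)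
      gcongr
    constructor
    · linarith
    · linarith

def tx (N m : ℕ) : ℚ := ∑ i ∈ Finset.range m, 1 / ((N - (i + 1) : ℕ) : ℚ)
def hy (m : ℕ) : ℚ := ∑ i ∈ Finset.range m, 1 / ((i + 1 : ℕ) : ℚ)
def ep (N m : ℕ) : ℚ := ∑ i ∈ Finset.range m, 1 / (((i + 1 : ℕ) : ℚ) * ((N - (i + 1) : ℕ) : ℚ))

lemma tx_nonneg (N m : ℕ) : 0 ≤ tx N m := Finset.sum_nonneg fun i _ => by positivity
lemma hy_nonneg (m : ℕ) : 0 ≤ hy m := Finset.sum_nonneg fun i _ => by positivity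
lemma ep_nonneg (N m : ℕ) : 0 ≤ ep N m := Finset.sum_nonneg fun i _ => by positivity

lemma tx_le (N m : ℕ) (h : m < N) : tx N m ≤ m / ((N - m : ℕ) : ℚ) := by
  have : tx N m ≤ ∑ i ∈ Finset.range m, 1 / ((N - m : ℕ) : ℚ) := by
    apply Finset.sum_le_sum
    intro i hi
    rw [Finset.mem_range] at hi
    apply one_div_le_one_div_of_le
    · norm_cast; omega
    · norm_cast; omega
  refine this.trans (le_of_eq ?_)
  rw [Finset.sum_const, Finset.card_range, nsmul_eq_mul, mul_one_div]

lemma invar (N m : ℕ) (hm : m < N) :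
    (∀ w, 0 ≤ cpsi 1 N m w) ∧
    (∀ w, Pw w → w ≠ [] → cpsi 1 N m w ≤ tx N m * (tx N m + hy m) ^ (w.length - 1)) ∧
    (∀ w, Pw w → 0 ≤ cpsi 1 N m w - cfl N m w) ∧
    (∀ w, Pw w → cpsi 1 N m w - cfl N m w ≤ ep N m * (1 + (tx N m + hy m)) ^ w.length) := by
  induction m with
  | zero =>
    refine ⟨?_, ?_, ?_, ?_⟩
    · intro w; cases w <;> simp [cpsi, dl]
    · intro w _ hw; cases w with
      | nil => exact absurd rfl hw
      | cons a w => simp [cpsi, dl, tx]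
    · intro w _; simp [cpsi, cfl]
    · intro w _; simp [cpsi, cfl, ep]
  | succ m ih =>
    obtain ⟨i1, i2, i3, i4⟩ := ih (by omega)
    have etx : tx N (m + 1) = tx N m + 1 / ((N - (m + 1) : ℕ) : ℚ) := Finset.sum_range_succ _ _
    have ehy : hy (m + 1) = hy m + 1 / ((m + 1 : ℕ) : ℚ) := Finset.sum_range_succ _ _
    have eep : ep N (m + 1) = ep N m + 1 / (((m + 1 : ℕ) : ℚ) * ((N - (m + 1) : ℕ) : ℚ)) :=
      Finset.sum_range_succ _ _
    have htx := tx_nonneg N m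
    have htx1 := tx_nonneg N (m + 1)
    have hhy := hy_nonneg m
    have hep := ep_nonneg N m
    have htl := tx_le N (m + 1) hm
    have hn0 : (0 : ℚ) < ((N - (m + 1) : ℕ) : ℚ) := by norm_cast; omega
    have hm0 : (0 : ℚ) < ((m + 1 : ℕ) : ℚ) := by norm_cast; omega
    set p : ℚ := 1 / ((N - (m + 1) : ℕ) : ℚ) with hp
    set q : ℚ := 1 / ((m + 1 : ℕ) : ℚ) with hq
    have hp0 : 0 ≤ p := by positivity
    have hq0 : 0 ≤ q := by positivity
    have hδ : 1 / (((m + 1 : ℕ) : ℚ) * ((N - (m + 1) : ℕ) : ℚ)) = q * p := by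
      rw [hp, hq]; field_simp
    rw [hδ] at eep
    have htl2 : q * tx N (m + 1) ≤ p := by
      calc q * tx N (m + 1) ≤ q * (((m + 1 : ℕ) : ℚ) / ((N - (m + 1) : ℕ) : ℚ)) := by gcongr
        _ = p := by rw [hp, hq]; field_simp
    have j1 : ∀ w, 0 ≤ gst true p (cpsi 1 N m) w := gst_nonneg _ _ hp0 _ i1
    have k1 : ∀ w, 0 ≤ gst false q (gst true p (cpsi 1 N m)) w := gst_nonneg _ _ hq0 _ j1
    have j2 : ∀ w, Pw w → w ≠ [] →
        gst true p (cpsi 1 N m) w ≤ tx N (m + 1) * (tx N m + hy m + p) ^ (w.length - 1) :=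
      gst_le_x true _ _ _ _ htx (by positivity) hp0 (by linarith) (fun _ => etx.ge) _ (cpsi_nil _ _ _) i2
    have k2 : ∀ w, Pw w → w ≠ [] →
        gst false q (gst true p (cpsi 1 N m)) w
          ≤ tx N (m + 1) * (tx N m + hy m + p + q) ^ (w.length - 1) :=
      gst_le_x false _ _ _ _ htx1 (by positivity) hq0 le_rfl (by simp) _
        (by rw [gst_nil, cpsi_nil]) j2
    have j3 : ∀ w, Pw w → 0 ≤ gst true p (cpsi 1 N m) w - gst true p (cfl N m) w := by
      intro w hw
      rw [← gst_sub]
      exact gst_nonneg' _ _ hp0 _ i3 w hw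
    have j4 : ∀ w, Pw w → gst true p (cpsi 1 N m) w - gst true p (cfl N m) w
        ≤ ep N m * (1 + (tx N m + hy m + p)) ^ w.length := by
      intro w hw
      rw [← gst_sub, ← add_assoc]
      exact gst_le _ _ _ _ hep (by positivity) hp0 _ i4 w hw
    have k34 := ystep _ _ q (ep N m) (q * p) (tx N m + hy m + p) hq0 hep (by positivity)
      (by positivity) j3 j4 (fun w _ _ => k1 w) (by
        intro w hw hw0
        have a1 : (tx N m + hy m + p + q) ^ (w.length - 1)
            ≤ (1 + (tx N m + hy m + p) + q) ^ w.length := by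
          calc (tx N m + hy m + p + q) ^ (w.length - 1)
              ≤ (1 + (tx N m + hy m + p) + q) ^ (w.length - 1) :=
                pow_le_pow_left₀ (by positivity) (by linarith) _
            _ ≤ _ := by
              apply pow_le_pow_right₀
              · have : 0 ≤ tx N m + hy m + p + q := by positivity
                linarith
              · omega
        calc q * (q * gst false q (gst true p (cpsi 1 N m)) w)
            ≤ q * (q * (tx N (m + 1) * (tx N m + hy m + p + q) ^ (w.length - 1))) := by
              gcongr; exact k2 w hw hw0
          _ = q * ((q * tx N (m + 1)) * (tx N m + hy m + p + q) ^ (w.length - 1)) := by ring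
          _ ≤ q * (p * (1 + (tx N m + hy m + p) + q) ^ w.length) := by gcongr
          _ = _ := by ring)
    have es : tx N (m + 1) + hy (m + 1) = tx N m + hy m + p + q := by rw [etx, ehy]; ring
    refine ⟨k1, ?_, ?_, ?_⟩
    · rw [es]; exact k2
    · exact fun w hw => (k34 w hw).1
    · intro w hw
      rw [es, eep, show 1 + (tx N m + hy m + p + q) = 1 + (tx N m + hy m + p) + q by ring]
      exact (k34 w hw).2

lemma tx_full (N : ℕ) : tx N (N - 1) = hy (N - 1) := by
  rw [hy, ← Finset.sum_range_reflect, tx]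
  apply Finset.sum_congr rfl
  intro i hi
  rw [Finset.mem_range] at hi
  congr 2
  omega

lemma ep_full (N : ℕ) : ep N (N - 1) = 2 * hy (N - 1) / N := by
  have h : 2 * hy (N - 1) = tx N (N - 1) + hy (N - 1) := by rw [tx_full]; ring
  rw [h, tx, hy, ep, ← Finset.sum_add_distrib, Finset.sum_div]
  apply Finset.sum_congr rfl
  intro i hi
  rw [Finset.mem_range] at hi
  have h1 : (N : ℚ) = ((N - (i + 1) : ℕ) : ℚ) + ((i + 1 : ℕ) : ℚ) := by norm_cast; omega
  have h2 : (0 : ℚ) < ((N - (i + 1) : ℕ) : ℚ) := by norm_cast; omega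
  have h3 : (0 : ℚ) < ((i + 1 : ℕ) : ℚ) := by norm_cast; omega
  rw [h1]
  field_simp
  ring

lemma hy_le (N : ℕ) (hN : 1 ≤ N) : ((hy (N - 1) : ℚ) : ℝ) ≤ 1 + Real.log N := by
  have h1 : hy (N - 1) ≤ harmonic N := by
    rw [hy, harmonic]
    have : Finset.range (N - 1) ⊆ Finset.range N := Finset.range_mono (by omega)
    refine le_trans (Finset.sum_le_sum_of_subset_of_nonneg this fun i _ _ => by positivity) ?_
    simp
  exact (Rat.cast_le.2 h1).trans (harmonic_le_one_add_log N)

lemma psi_K_tendsto (w : List Bool) (hw : Pw w) :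
    Filter.Tendsto (fun N : ℕ => ((psi N w - K N w : ℚ) : ℝ)) Filter.atTop (nhds 0) := by
  have hlim : Filter.Tendsto (fun N : ℕ => 5 ^ (w.length + 1) *
      (Real.log (N : ℝ) ^ (w.length + 1) / (N : ℝ))) Filter.atTop (nhds 0) := by
    have := (Real.isLittleO_pow_log_id_atTop (n := w.length + 1)).tendsto_div_nhds_zero
    have := (this.comp tendsto_natCast_atTop_atTop).const_mul (5 ^ (w.length + 1) : ℝ)
    simpa using this
  refine squeeze_zero' ?_ ?_ hlim
  · filter_upwards [Filter.eventually_ge_atTop 3] with N hN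
    exact_mod_cast (invar N (N - 1) (by omega)).2.2.1 w hw
  · filter_upwards [Filter.eventually_ge_atTop 3] with N hN
    have h := (invar N (N - 1) (by omega)).2.2.2 w hw
    rw [ep_full, tx_full] at h
    have hh := hy_nonneg (N - 1)
    have hN0 : (0 : ℚ) < N := by norm_cast; omega
    have hN1 : (0 : ℝ) < N := by norm_cast; omega
    have h2 : psi N w - K N w ≤ (1 + 2 * hy (N - 1)) ^ (w.length + 1) / N := by
      refine h.trans ?_
      rw [div_mul_eq_mul_div, pow_succ', ← two_mul]
      gcongr
      linarith
    have h3 : ((psi N w - K N w : ℚ) : ℝ) ≤ (1 + 2 * ((hy (N - 1) : ℚ) : ℝ)) ^ (w.length + 1) / N := by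
      exact_mod_cast h2
    have hlog : 1 ≤ Real.log N := by
      rw [Real.le_log_iff_exp_le hN1]
      have := Real.exp_one_lt_d9
      have : (3 : ℝ) ≤ N := by exact_mod_cast hN
      linarith
    have h4 := hy_le N (by omega)
    have hhR : (0 : ℝ) ≤ ((hy (N - 1) : ℚ) : ℝ) := by exact_mod_cast hh
    refine h3.trans ?_
    rw [mul_div_assoc', ← mul_pow]
    gcongr
    linarith

end MZ

namespace MZ

/-! ### limits of truncated sums -/

lemma zrec_nonneg (ks : List ℕ) (N : ℕ) : 0 ≤ zrec ks N := by
  induction ks generalizing N with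
  | nil => simp [zrec]
  | cons k ks ih =>
    rw [zrec]
    exact Finset.sum_nonneg fun n _ => mul_nonneg (by positivity) (ih n)

lemma zrec_mono (ks : List ℕ) : Monotone (fun N => ((zrec ks N : ℚ) : ℝ)) := by
  intro N M h
  apply Rat.cast_le.2
  cases ks with
  | nil => simp [zrec]
  | cons k ks =>
    rw [zrec, zrec]
    exact Finset.sum_le_sum_of_subset_of_nonneg (Finset.Ico_subset_Ico_right h)
      fun n _ _ => mul_nonneg (by positivity) (zrec_nonneg ks n)

lemma zrec_bdd (ks : List ℕ) (h : ∀ a ∈ ks, 2 ≤ a) : ∃ C : ℝ, ∀ N, ((zrec ks N : ℚ) : ℝ) ≤ C := by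
  induction ks with
  | nil => exact ⟨1, fun N => by simp [zrec]⟩
  | cons k ks ih =>
    simp only [List.mem_cons, forall_eq_or_imp] at h
    obtain ⟨C, hC⟩ := ih h.2
    have hs : Summable fun n : ℕ => 1 / (n : ℝ) ^ k := Real.summable_one_div_nat_pow.2 (by omega)
    have hC0 : 0 ≤ C := le_trans (by exact_mod_cast zrec_nonneg ks 0) (hC 0)
    refine ⟨(∑' n : ℕ, 1 / (n : ℝ) ^ k) * C, fun N => ?_⟩
    rw [zrec]
    push_cast
    calc ∑ n ∈ Finset.Ico 1 N, 1 / (n : ℝ) ^ k * ((zrec ks n : ℚ) : ℝ)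
        ≤ ∑ n ∈ Finset.Ico 1 N, 1 / (n : ℝ) ^ k * C :=
          Finset.sum_le_sum fun n _ => mul_le_mul_of_nonneg_left (hC n) (by positivity)
      _ = (∑ n ∈ Finset.Ico 1 N, 1 / (n : ℝ) ^ k) * C := by rw [Finset.sum_mul]
      _ ≤ _ := mul_le_mul_of_nonneg_right (hs.sum_le_tsum _ fun n _ => by positivity) hC0

noncomputable def ell (ks : List ℕ) : ℝ := ⨆ N, ((zrec ks N : ℚ) : ℝ)

lemma ell_tendsto (ks : List ℕ) (h : ∀ a ∈ ks, 2 ≤ a) :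
    Filter.Tendsto (fun N => ((zrec ks N : ℚ) : ℝ)) Filter.atTop (nhds (ell ks)) := by
  obtain ⟨C, hC⟩ := zrec_bdd ks h
  exact tendsto_atTop_ciSup (zrec_mono ks) ⟨C, by rintro _ ⟨N, rfl⟩; exact hC N⟩

lemma V_tendsto (k : ℕ) (f : ℕ → ℚ) (hf : f ∈ V k) :
    ∃ x ∈ Submodule.span ℚ (((G k).image ell : Finset ℝ) : Set ℝ),
      Filter.Tendsto (fun N => ((f N : ℚ) : ℝ)) Filter.atTop (nhds x) := by
  induction hf using Submodule.span_induction with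
  | mem x h =>
    obtain ⟨ks, hks, rfl⟩ := h
    exact ⟨ell ks, Submodule.subset_span (by simpa using ⟨ks, hks, rfl⟩), ell_tendsto ks (G_two k ks hks)⟩
  | zero => exact ⟨0, Submodule.zero_mem _, by simp⟩
  | add x y _ _ hx hy =>
    obtain ⟨a, ha, ha'⟩ := hx
    obtain ⟨b, hb, hb'⟩ := hy
    exact ⟨a + b, Submodule.add_mem _ ha hb, by simpa using ha'.add hb'⟩
  | smul c x _ hx =>
    obtain ⟨a, ha, ha'⟩ := hx
    refine ⟨c • a, Submodule.smul_mem _ c ha, ?_⟩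
    simpa [Rat.smul_def] using ha'.const_mul (c : ℝ)

lemma zrec_tendsto (k : ℕ) (ks : List ℕ) (hk : 2 ≤ k) (h : ∀ a ∈ ks, 1 ≤ a) :
    ∃ x ∈ Submodule.span ℚ (((G (k + ks.sum)).image ell : Finset ℝ) : Set ℝ),
      Filter.Tendsto (fun N => ((zrec (k :: ks) N : ℚ) : ℝ)) Filter.atTop (nhds x) := by
  have h1 : ∀ a ∈ k :: ks, 1 ≤ a := by
    simp only [List.mem_cons, forall_eq_or_imp]
    exact ⟨by omega, h⟩
  have had := word_ad k ks hk
  have hl := word_length (k :: ks) h1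
  rw [List.sum_cons] at hl
  obtain ⟨x, hx, hx'⟩ := V_tendsto _ _ (psi_mem _ (word (k :: ks)) hl (Or.inr had))
  refine ⟨x, hx, ?_⟩
  have hP : Pw (word (k :: ks)) := by rw [Pw, had.2]; simp
  have := hx'.sub (psi_K_tendsto _ hP)
  rw [sub_zero] at this
  refine this.congr fun N => ?_
  rw [K_word _ h1]
  push_cast
  ring

/-! ### connection with multiple zeta values -/

noncomputable def Tf (r N : ℕ) : Finset (Fin r → ℕ) :=
  (Fintype.piFinset fun _ => Finset.Ico 1 N).filter StrictMono

lemma mem_Tf (r N : ℕ) (n : Fin r → ℕ) : n ∈ Tf r N ↔ (∀ i, 1 ≤ n i ∧ n i < N) ∧ StrictMono n := by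
  simp [Tf]

lemma strictMono_snoc' {r : ℕ} (n : Fin r → ℕ) (m : ℕ) (hn : StrictMono n) (h : ∀ i, n i < m) :
    StrictMono (Fin.snoc n m : Fin (r + 1) → ℕ) := by
  intro i j hij
  induction j using Fin.lastCases with
  | last =>
    induction i using Fin.lastCases with
    | last => exact absurd hij (lt_irrefl _)
    | cast i => simpa using h i
  | cast j =>
    induction i using Fin.lastCases with
    | last => exact absurd hij (not_lt.2 (Fin.le_last _))
    | cast i => simpa using hn (by simpa using hij)

lemma Tf_sum (r : ℕ) (e : Fin r → ℕ) (N : ℕ) :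
    ∑ n ∈ Tf r N, ∏ i, (1 : ℝ) / ((n i : ℝ) ^ e i) = ((zrec (List.ofFn e).reverse N : ℚ) : ℝ) := by
  induction r generalizing N with
  | zero =>
    have : Tf 0 N = Finset.univ := by
      ext n; simp [mem_Tf, Subsingleton.strictMono, eq_iff_true_of_subsingleton]
    rw [this]
    simp [zrec]
  | succ r ih =>
    rw [List.ofFn_succ_last, List.reverse_append, List.reverse_singleton, List.singleton_append, zrec]
    push_cast
    have : ∀ m ∈ Finset.Ico 1 N, 1 / (m : ℝ) ^ e (Fin.last r) *
        ((zrec (List.ofFn fun i => e i.castSucc).reverse m : ℚ) : ℝ)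
        = ∑ n ∈ Tf r m, ∏ i, (1 : ℝ) / (((Fin.snoc n m : Fin (r + 1) → ℕ) i : ℝ) ^ e i) := by
      intro m _
      rw [← ih, Finset.mul_sum]
      apply Finset.sum_congr rfl
      intro n _
      rw [Fin.prod_univ_castSucc]
      simp [mul_comm]
    rw [Finset.sum_congr rfl this, Finset.sum_sigma']
    refine Finset.sum_bij' (fun n _ => ⟨n (Fin.last r), Fin.init n⟩)
      (fun p _ => (Fin.snoc p.2 p.1 : Fin (r + 1) → ℕ)) ?_ ?_ ?_ ?_ ?_
    · intro n hn
      rw [mem_Tf] at hn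
      rw [Finset.mem_sigma, Finset.mem_Ico, mem_Tf]
      exact ⟨hn.1 _, fun i => ⟨(hn.1 _).1, hn.2 (Fin.castSucc_lt_last i)⟩,
        hn.2.comp Fin.strictMono_castSucc⟩
    · rintro ⟨m, n⟩ hn
      rw [Finset.mem_sigma, Finset.mem_Ico, mem_Tf] at hn
      obtain ⟨h1, h2, h3⟩ := hn
      simp only at h1 h2 h3
      rw [mem_Tf]
      refine ⟨fun i => ?_, strictMono_snoc' n m h3 fun i => (h2 i).2⟩
      induction i using Fin.lastCases with
      | last => simpa using h1
      | cast i => simpa using ⟨(h2 i).1, (h2 i).2.trans h1.2⟩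
    · intro n _
      exact Fin.snoc_init_self n
    · rintro ⟨m, n⟩ _
      simp
    · intro n _
      simp only [Fin.snoc_init_self]

lemma mzvL_eq (κ : List ℕ) (x : ℝ)
    (hx : Filter.Tendsto (fun N => ((zrec κ.reverse N : ℚ) : ℝ)) Filter.atTop (nhds x)) :
    mzvL κ = x := by
  let p : (Fin κ.length → ℕ) → Prop := fun n => StrictMono n ∧ ∀ i, 0 < n i
  let f : (Fin κ.length → ℕ) → ℝ := fun n => ∏ i, (1 : ℝ) / ((n i : ℝ) ^ κ.get i)
  let S : ℕ → Finset {n // p n} := fun N => (Tf κ.length N).subtype p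
  have hp : ∀ N, ∀ n ∈ Tf κ.length N, p n := fun N n hn => by
    rw [mem_Tf] at hn
    exact ⟨hn.2, fun i => (hn.1 i).1⟩
  have hS : ∀ N, ∑ n ∈ S N, f n.1 = ((zrec κ.reverse N : ℚ) : ℝ) := by
    intro N
    rw [Finset.sum_subtype_of_mem f (hp N)]
    have := Tf_sum κ.length κ.get N
    rw [List.ofFn_get] at this
    exact this
  have hmono : Monotone S := by
    intro N M h n hn
    simp only [S, Finset.mem_subtype, mem_Tf] at hn ⊢
    exact ⟨fun i => ⟨(hn.1 i).1, (hn.1 i).2.trans_le h⟩, hn.2⟩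
  have hex : ∀ n : {n // p n}, ∃ N, n ∈ S N := by
    rintro ⟨n, hn⟩
    refine ⟨∑ i, n i + 1, ?_⟩
    simp only [S, Finset.mem_subtype, mem_Tf]
    refine ⟨fun i => ⟨hn.2 i, ?_⟩, hn.1⟩
    have := Finset.single_le_sum (f := n) (fun j _ => Nat.zero_le _) (Finset.mem_univ i)
    omega
  have ht := Filter.tendsto_atTop_finset_of_monotone hmono hex
  have hnn : 0 ≤ fun n : {n // p n} => f n.1 := fun n => Finset.prod_nonneg fun i _ => by positivity
  have hsum : Summable fun n : {n // p n} => f n.1 := by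
    apply summable_of_sum_le hnn (c := x)
    intro u
    obtain ⟨N, hN⟩ := (ht.eventually (Filter.eventually_ge_atTop u)).exists
    calc ∑ n ∈ u, f n.1 ≤ ∑ n ∈ S N, f n.1 :=
          Finset.sum_le_sum_of_subset_of_nonneg hN fun n _ _ => hnn n
      _ ≤ x := by rw [hS]; exact (zrec_mono κ.reverse).ge_of_tendsto hx N
  have h2 := hsum.hasSum.comp ht
  have h3 : Filter.Tendsto (fun N => ∑ n ∈ S N, f n.1) Filter.atTop (nhds x) := by
    simpa only [hS] using hx
  exact tendsto_nhds_unique h2 h3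

end MZ

theorem rank_mzv_le_fib (k : ℕ) (hk : 2 ≤ k) :
    Module.rank ℚ ↥(Submodule.span ℚ {x : ℝ | ∃ κ : Composition k,
        (∃ m, κ.blocks.getLast? = some m ∧ 2 ≤ m) ∧ x = mzvL κ.blocks})
      ≤ (Nat.fib (k - 1) : Cardinal) := by
  have hle : Submodule.span ℚ {x : ℝ | ∃ κ : Composition k,
        (∃ m, κ.blocks.getLast? = some m ∧ 2 ≤ m) ∧ x = mzvL κ.blocks}
      ≤ Submodule.span ℚ (((MZ.G k).image MZ.ell : Finset ℝ) : Set ℝ) := by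
    rw [Submodule.span_le]
    rintro _ ⟨κ, ⟨m, hm, hm2⟩, rfl⟩
    obtain ⟨ks, hks⟩ : ∃ ks, κ.blocks.reverse = m :: ks := by
      rw [← List.head?_reverse] at hm
      exact List.head?_eq_some_iff.1 hm
    have hsum : m + ks.sum = k := by
      rw [← List.sum_cons, ← hks, List.sum_reverse, κ.blocks_sum]
    have hpos : ∀ a ∈ ks, 1 ≤ a := by
      intro a ha
      apply κ.blocks_pos
      rw [← List.mem_reverse, hks]
      exact List.mem_cons_of_mem _ ha
    obtain ⟨x, hx, hx'⟩ := MZ.zrec_tendsto m ks hm2 hpos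
    rw [← hks] at hx'
    rw [MZ.mzvL_eq κ.blocks x hx']
    rw [hsum] at hx
    exact hx
  refine (Submodule.rank_mono hle).trans ((rank_span_finset_le _).trans ?_)
  obtain ⟨j, rfl⟩ : ∃ j, k = j + 2 := ⟨k - 2, by omega⟩
  have := (Finset.card_image_le (s := MZ.G (j + 2)) (f := MZ.ell)).trans (MZ.G_card j)
  exact_mod_cast this
end
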